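/- Under the stated hypotheses, the L-incoherent (L,L,L) three-term relation holds: S(g)·A(1+a−f, 1+b−f, 1+c−f, 1+d−f)·A(e−a, e−b, e−c, e−d)·L(a,b,c,d;e;f,g) + S(e−f)·A(a,b,c,d)·A(g−a, g−b, g−c, g−d)·L(1−a, 1−b, 1−c, 1−d; 2−e; 2−f, 2−g) − B_3(a,b,c,d,e,f,g)·L(a,b,c,d;f;e,g) = 0. -/

import Mathlib

noncomputable section

open Complex

/-- `Sn x = sin (π x)`. -/
def Sn (x : ℂ) : ℂ := Complex.sin ((Real.pi : ℂ) * x)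

/-- The renormalized Saalschützian series
`F*(a,b,c,d;e,f,g) = ∑ₖ Γ(k+a)Γ(k+b)Γ(k+c)Γ(k+d)/(k!·Γ(k+e)Γ(k+f)Γ(k+g))`. -/
def Fstar (a b c d e f g : ℂ) : ℂ :=
  ∑' k : ℕ, (Complex.Gamma (k + a) * Complex.Gamma (k + b) *
      Complex.Gamma (k + c) * Complex.Gamma (k + d)) /
    ((k.factorial : ℂ) * Complex.Gamma (k + e) * Complex.Gamma (k + f) *
      Complex.Gamma (k + g))

/-- The function `K(a;b,c,d;e,f,g)`. -/
def Kf (a b c d e f g : ℂ) : ℂ :=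
  (Fstar a b c d e f g +
      Fstar a (1 + a - e) (1 + a - f) (1 + a - g) (1 + a - b) (1 + a - c) (1 + a - d)) /
    (Sn a * Complex.Gamma a ^ 2 * Complex.Gamma b * Complex.Gamma c * Complex.Gamma d *
      Complex.Gamma (1 + a - e) * Complex.Gamma (1 + a - f) * Complex.Gamma (1 + a - g))

/-- The function `L(a,b,c,d;e;f,g)`. -/
def Lf (a b c d e f g : ℂ) : ℂ :=
  (Fstar a b c d e f g -
      Fstar (1 + a - e) (1 + b - e) (1 + c - e) (1 + d - e) (2 - e) (1 + f - e) (1 + g - e)) /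
    (Sn e * Complex.Gamma a * Complex.Gamma b * Complex.Gamma c * Complex.Gamma d *
      Complex.Gamma (1 + a - e) * Complex.Gamma (1 + b - e) * Complex.Gamma (1 + c - e) *
      Complex.Gamma (1 + d - e))

/-- `A(x,y,z,t) = 1/(Γ(x)Γ(y)Γ(z)Γ(t))`. -/
def Af (x y z t : ℂ) : ℂ :=
  1 / (Complex.Gamma x * Complex.Gamma y * Complex.Gamma z * Complex.Gamma t)

def B1 (a b c d e f g : ℂ) : ℂ :=
  Sn b * Sn c * (Sn (b - a) * Sn (c - a) * Sn d + Sn (e - a) * Sn (f - a) * Sn (g - a)) /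
    (Real.pi : ℂ) ^ 4

def B2 (a b c d e f g : ℂ) : ℂ :=
  Sn (f - a) * Sn (g - a) *
    (Sn (b - a) * Sn (c - a) * Sn (d - a) + Sn (e - 2 * a) * Sn (f - a) * Sn (g - a)) /
    (Real.pi : ℂ) ^ 4

def B3 (a b c d e f g : ℂ) : ℂ :=
  (Sn f * Sn (f - e) * Sn (g - a) * Sn (g - b) * Sn (g - c) * Sn (g - d) -
      Sn g * Sn (g - e) * Sn (f - a) * Sn (f - b) * Sn (f - c) * Sn (f - d)) /
    ((Real.pi : ℂ) ^ 4 * Sn (f - g))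

def B4 (a b c d e f g : ℂ) : ℂ :=
  Sn (f - a) * Sn (g - a) * (Sn b * Sn c * Sn d + Sn (e - a) * Sn f * Sn g) /
    (Real.pi : ℂ) ^ 4

def B5 (a b c d e f g : ℂ) : ℂ :=
  Sn b * Sn (e - b) *
    (Sn (b - a) * Sn (c - a) * Sn (d - a) + Sn (e - 2 * a) * Sn (f - a) * Sn (g - a)) /
    (Real.pi : ℂ) ^ 4

def Cf (a b c d e f g : ℂ) : ℂ :=
  Sn (e - a) * (Sn b * Sn c * Sn d * B2 a b c d e f g +
      Sn e * Sn (f - a) * Sn (g - a) * B4 a b c d e f g) / (Real.pi : ℂ) ^ 4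

section

open Filter Topology Finset

/-- The rising factorial `x (x + 1) ⋯ (x + k - 1)`. -/
def poch (x : ℂ) (k : ℕ) : ℂ := ∏ j ∈ range k, (x + j)

@[simp] lemma poch_zero (x : ℂ) : poch x 0 = 1 := by simp [poch]

lemma poch_succ (x : ℂ) (k : ℕ) : poch x (k + 1) = poch x k * (x + k) := by
  simp [poch, prod_range_succ]

lemma poch_ne_zero {x : ℂ} (hx : ∀ m : ℕ, x ≠ -m) (k : ℕ) : poch x k ≠ 0 :=
  prod_ne_zero_iff.2 fun j _ h => hx j (eq_neg_of_add_eq_zero_left h)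

lemma inv_Gamma_eq (x : ℂ) (k : ℕ) : (Gamma x)⁻¹ = poch x k * (Gamma (x + k))⁻¹ := by
  induction k with
  | zero => simp
  | succ k ih =>
    rw [ih, poch_succ, one_div_Gamma_eq_self_mul_one_div_Gamma_add_one]
    push_cast
    ring_nf

lemma Gamma_add_nat {x : ℂ} (hx : ∀ m : ℕ, x ≠ -m) (k : ℕ) :
    Gamma (x + k) = poch x k * Gamma x := by
  have h := inv_Gamma_eq x k
  have h1 := Gamma_ne_zero hx
  have h2 : Gamma (x + k) ≠ 0 := by
    intro h0
    rw [h0] at h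
    simp [h1] at h
  field_simp at h
  linear_combination h

lemma ne_neg_nat_of_re_pos {x : ℂ} (hx : 0 < x.re) (m : ℕ) : x ≠ -m := by
  rintro rfl
  simp at hx
  linarith [(Nat.cast_nonneg m : (0 : ℝ) ≤ m)]

lemma ne_neg_nat_of_ne_int {x : ℂ} (hx : ∀ n : ℤ, x ≠ n) (m : ℕ) : x ≠ -m := by
  have := hx (-m)
  push_cast at this
  exact this

lemma norm_one_add_le_exp (w : ℂ) : ‖1 + w‖ ≤ Real.exp (w.re + ‖w‖ ^ 2 / 2) := by
  have h : ‖1 + w‖ ^ 2 ≤ Real.exp (w.re + ‖w‖ ^ 2 / 2) ^ 2 := by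
    rw [← Real.exp_nat_mul, Complex.sq_norm, Complex.sq_norm, normSq_apply, normSq_apply]
    refine le_trans (le_of_eq ?_) (Real.add_one_le_exp _)
    simp
    ring
  exact le_of_sq_le_sq h (Real.exp_pos _).le

lemma norm_inv_one_add_le_exp {w : ℂ} (hw : ‖w‖ ≤ 1 / 2) :
    ‖(1 + w)⁻¹‖ ≤ Real.exp (-w.re + 4 * ‖w‖ ^ 2) := by
  have h1 : 1 / 2 ≤ ‖1 + w‖ := by
    have := norm_sub_norm_le (1 : ℂ) (-w)
    simp at this
    linarith
  have h0 : (1 + w) ≠ 0 := by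
    intro h
    rw [h] at h1
    norm_num at h1
  have h2 : (1 + w)⁻¹ = 1 + -w * (1 + w)⁻¹ := by field_simp; ring
  have h3 : -w * (1 + w)⁻¹ = -w + w ^ 2 * (1 + w)⁻¹ := by field_simp; ring
  have h4 : ‖(1 + w)⁻¹‖ ≤ 2 := by
    rw [norm_inv, inv_le_comm₀ (by linarith) (by norm_num)]
    linarith
  have h5 : (-w * (1 + w)⁻¹).re ≤ -w.re + 2 * ‖w‖ ^ 2 := by
    rw [h3, add_re, neg_re]
    have := re_le_norm (w ^ 2 * (1 + w)⁻¹)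
    rw [norm_mul, norm_pow] at this
    nlinarith [sq_nonneg ‖w‖]
  have h6 : ‖-w * (1 + w)⁻¹‖ ≤ 2 * ‖w‖ := by
    rw [norm_mul, norm_neg]
    nlinarith [norm_nonneg w]
  rw [h2]
  refine (norm_one_add_le_exp _).trans (Real.exp_le_exp.2 ?_)
  have : ‖-w * (1 + w)⁻¹‖ ^ 2 ≤ (2 * ‖w‖) ^ 2 := by gcongr
  nlinarith

lemma abs_harmonic_sub_log_le (k : ℕ) :
    |(∑ j ∈ range k, (1 : ℝ) / (j + 1)) - Real.log (k + 1)| ≤ 1 := by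
  have h : (∑ j ∈ range k, (1 : ℝ) / (j + 1)) = (harmonic k : ℝ) := by
    simp [harmonic]
  rw [h, abs_le]
  have h1 := log_add_one_le_harmonic k
  have h2 := harmonic_le_one_add_log k
  push_cast at h1
  have h3 : Real.log k ≤ Real.log (k + 1) := by
    rcases Nat.eq_zero_or_pos k with rfl | hk
    · simp
    · exact Real.log_le_log (by exact_mod_cast hk) (by linarith)
  constructor <;> linarith

lemma sum_inv_sq_le (k : ℕ) : ∑ j ∈ range k, (1 : ℝ) / (j + 1) ^ 2 ≤ 2 := by
  have h : ∀ n : ℕ, ∑ j ∈ range (n + 1), (1 : ℝ) / (j + 1) ^ 2 ≤ 2 - 1 / ((n : ℝ) + 1) := by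
    intro n
    induction n with
    | zero => norm_num
    | succ n ih =>
      rw [sum_range_succ]
      have h : (1 : ℝ) / ((n + 1 : ℕ) + 1) ^ 2 ≤ 1 / (n + 1) - 1 / ((n + 1 : ℕ) + 1) := by
        push_cast
        rw [div_sub_div _ _ (by positivity) (by positivity),
          div_le_div_iff₀ (by positivity) (by positivity)]
        have : (0 : ℝ) ≤ n := n.cast_nonneg
        nlinarith
      linarith
  rcases k with _ | k
  · simp
  · linarith [h k, (by positivity : (0 : ℝ) ≤ 1 / ((k : ℝ) + 1))]

lemma mul_harmonic_le {s M : ℝ} (hs : |s| ≤ M) (k : ℕ) :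
    s * (∑ j ∈ range k, (1 : ℝ) / (j + 1)) ≤ s * Real.log (k + 1) + M := by
  have h := abs_harmonic_sub_log_le k
  have : |s * ((∑ j ∈ range k, (1 : ℝ) / (j + 1)) - Real.log (k + 1))| ≤ M * 1 := by
    rw [abs_mul]
    gcongr
    exact (abs_nonneg _).trans hs
  linarith [le_abs_self (s * ((∑ j ∈ range k, (1 : ℝ) / (j + 1)) - Real.log (k + 1)))]

lemma exists_norm_poch_le (M : ℝ) : ∃ K : ℝ, 0 < K ∧ ∀ x : ℂ, ‖x‖ ≤ M → ∀ k : ℕ,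
    ‖poch x k‖ ≤ K * (k.factorial * ((k : ℝ) + 1) ^ (x.re - 1)) := by
  refine ⟨Real.exp ((M + 1) ^ 2 + (M + 1)), Real.exp_pos _, fun x hx k => ?_⟩
  have h1 : ‖poch x k‖ ≤ k.factorial * Real.exp ((x.re - 1) * (∑ j ∈ range k, (1 : ℝ) / (j + 1)) +
      (M + 1) ^ 2 / 2 * ∑ j ∈ range k, (1 : ℝ) / (j + 1) ^ 2) := by
    induction k with
    | zero => simp
    | succ k ih =>
      have hk : ((k : ℂ) + 1) ≠ 0 := by exact_mod_cast k.succ_ne_zero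
      have hk' : (0 : ℝ) < (k : ℝ) + 1 := by positivity
      have h2 : x + k = (k + 1) * (1 + (x - 1) / (k + 1)) := by field_simp; ring
      have hn : ‖(k : ℂ) + 1‖ = (k : ℝ) + 1 := by
        exact_mod_cast Complex.norm_natCast (k + 1)
      have h3 : ‖x + k‖ ≤ (k + 1) * Real.exp ((x.re - 1) * (1 / (k + 1)) +
          (M + 1) ^ 2 / 2 * (1 / (k + 1) ^ 2)) := by
        rw [h2, norm_mul, hn]
        gcongr
        refine (norm_one_add_le_exp _).trans (Real.exp_le_exp.2 ?_)
        have e1 : ((x - 1) / (k + 1)).re = (x.re - 1) * (1 / (k + 1)) := by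
          have : (x - 1) / ((k : ℂ) + 1) = (x - 1) * (((1 / (k + 1) : ℝ)) : ℂ) := by
            push_cast; ring
          rw [this, re_mul_ofReal]; simp
        have e2 : ‖x - 1‖ ≤ M + 1 := (norm_sub_le _ _).trans (by simpa using hx)
        rw [e1, norm_div, hn]
        have : ‖x - 1‖ ^ 2 ≤ (M + 1) ^ 2 := by gcongr
        refine add_le_add le_rfl ?_
        rw [div_pow, mul_one_div, div_right_comm]
        gcongr
      rw [poch_succ, norm_mul, sum_range_succ, sum_range_succ, Nat.factorial_succ]
      refine (mul_le_mul ih h3 (norm_nonneg _) (by positivity)).trans (le_of_eq ?_)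
      rw [mul_mul_mul_comm, ← Real.exp_add]
      push_cast
      ring_nf
  refine h1.trans ?_
  rw [mul_left_comm]
  refine mul_le_mul_of_nonneg_left ?_ (by positivity)
  rw [Real.rpow_def_of_pos (by positivity), ← Real.exp_add]
  refine Real.exp_le_exp.2 ?_
  have h4 : |x.re - 1| ≤ M + 1 := (abs_sub _ _).trans (by
    have := (abs_re_le_norm x).trans hx
    simpa using this)
  have := mul_harmonic_le h4 k
  have h5 := sum_inv_sq_le k
  nlinarith [sq_nonneg (M + 1)]

lemma exists_norm_inv_Gamma_le (M : ℝ) : ∃ K : ℝ, 0 < K ∧ ∀ x : ℂ, ‖x‖ ≤ M → ∀ k : ℕ,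
    ‖(Gamma (x + k))⁻¹‖ ≤ K * ((k.factorial : ℝ)⁻¹ * ((k : ℝ) + 1) ^ (1 - x.re)) := by
  obtain ⟨J, hJ⟩ := exists_nat_ge (2 * (M + 1))
  obtain ⟨B, hB⟩ := (isCompact_closedBall (0 : ℂ) (M + J)).exists_bound_of_continuousOn
    differentiable_one_div_Gamma.continuous.continuousOn
  obtain ⟨B', hB'⟩ : ∃ B' : ℝ, B' = (|B| + 1) * (J.factorial * Real.exp ((M + 1) * J)) :=
    ⟨_, rfl⟩
  have hB'0 : 0 < B' := by rw [hB']; positivity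
  refine ⟨B' * Real.exp ((M + 1) + 8 * (M + 1) ^ 2), by positivity, fun x hx k => ?_⟩
  have hM : 0 ≤ M := (norm_nonneg x).trans hx
  have hre := (abs_re_le_norm x).trans hx
  have hre' := abs_le.1 hre
  have h1 : ‖(Gamma (x + k))⁻¹‖ ≤ B' * ((k.factorial : ℝ)⁻¹ *
      Real.exp ((1 - x.re) * (∑ j ∈ range k, (1 : ℝ) / (j + 1)) +
      4 * (M + 1) ^ 2 * ∑ j ∈ range k, (1 : ℝ) / (j + 1) ^ 2)) := by
    have small : ∀ k ≤ J, ‖(Gamma (x + k))⁻¹‖ ≤ B' * ((k.factorial : ℝ)⁻¹ *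
      Real.exp ((1 - x.re) * (∑ j ∈ range k, (1 : ℝ) / (j + 1)) +
      4 * (M + 1) ^ 2 * ∑ j ∈ range k, (1 : ℝ) / (j + 1) ^ 2)) := by
      intro k hk
      have e1 : ‖(Gamma (x + k))⁻¹‖ ≤ |B| + 1 := by
        refine (hB (x + k) ?_).trans ((le_abs_self B).trans (by linarith))
        rw [mem_closedBall_zero_iff]
        refine (norm_add_le _ _).trans (add_le_add hx ?_)
        rw [Complex.norm_natCast]
        exact_mod_cast hk
      have e2 : (∑ j ∈ range k, (1 : ℝ) / (j + 1)) ≤ J := by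
        calc (∑ j ∈ range k, (1 : ℝ) / (j + 1)) ≤ ∑ j ∈ range k, (1 : ℝ) := by
              refine sum_le_sum fun j _ => ?_
              rw [div_le_one (by positivity)]
              linarith [(Nat.cast_nonneg j : (0 : ℝ) ≤ j)]
          _ ≤ J := by simpa using hk
      have e2' : 0 ≤ (∑ j ∈ range k, (1 : ℝ) / (j + 1)) := sum_nonneg fun j _ => by positivity
      have e3 : (J.factorial : ℝ)⁻¹ ≤ (k.factorial : ℝ)⁻¹ := by
        gcongr
      have e4 : Real.exp (-((M + 1) * J)) ≤ Real.exp ((1 - x.re) *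
          (∑ j ∈ range k, (1 : ℝ) / (j + 1)) +
          4 * (M + 1) ^ 2 * ∑ j ∈ range k, (1 : ℝ) / (j + 1) ^ 2) := by
        refine Real.exp_le_exp.2 ?_
        have : 0 ≤ 4 * (M + 1) ^ 2 * ∑ j ∈ range k, (1 : ℝ) / (j + 1) ^ 2 :=
          mul_nonneg (by positivity) (sum_nonneg fun j _ => by positivity)
        nlinarith
      calc ‖(Gamma (x + k))⁻¹‖ ≤ |B| + 1 := e1
        _ = B' * ((J.factorial : ℝ)⁻¹ * Real.exp (-((M + 1) * J))) := by
          rw [hB', Real.exp_neg]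
          field_simp
        _ ≤ _ := by gcongr
    induction k with
    | zero => exact small 0 (Nat.zero_le _)
    | succ k ih =>
      rcases le_or_gt (k + 1) J with h | h
      · exact small _ h
      · have hkJ : (J : ℝ) ≤ k := by exact_mod_cast Nat.lt_succ_iff.1 h
        have hk : ((k : ℂ) + 1) ≠ 0 := by exact_mod_cast k.succ_ne_zero
        have hk' : (0 : ℝ) < (k : ℝ) + 1 := by positivity
        have h2 : x + k = (k + 1) * (1 + (x - 1) / (k + 1)) := by field_simp; ring
        have hn : ‖(k : ℂ) + 1‖ = (k : ℝ) + 1 := by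
          exact_mod_cast Complex.norm_natCast (k + 1)
        have e2 : ‖x - 1‖ ≤ M + 1 := (norm_sub_le _ _).trans (by simpa using hx)
        have hw : ‖(x - 1) / ((k : ℂ) + 1)‖ ≤ 1 / 2 := by
          rw [norm_div, hn, div_le_div_iff₀ hk' (by norm_num)]
          linarith
        have hx0 : x + k ≠ 0 := by
          intro h0
          have h3 : x = -(k : ℂ) := eq_neg_of_add_eq_zero_left h0
          have h4 : ‖x‖ = k := by rw [h3, norm_neg, Complex.norm_natCast]
          linarith
        have h3 : ‖(x + k)⁻¹‖ ≤ ((k : ℝ) + 1)⁻¹ * Real.exp ((1 - x.re) * (1 / (k + 1)) +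
            4 * (M + 1) ^ 2 * (1 / (k + 1) ^ 2)) := by
          rw [h2, mul_inv, norm_mul, norm_inv, hn]
          gcongr
          refine (norm_inv_one_add_le_exp hw).trans (Real.exp_le_exp.2 ?_)
          have e1 : ((x - 1) / (k + 1)).re = (x.re - 1) * (1 / (k + 1)) := by
            have : (x - 1) / ((k : ℂ) + 1) = (x - 1) * (((1 / (k + 1) : ℝ)) : ℂ) := by
              push_cast; ring
            rw [this, re_mul_ofReal]; simp
          rw [e1, norm_div, hn]
          have : ‖x - 1‖ ^ 2 ≤ (M + 1) ^ 2 := by gcongr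
          refine add_le_add (by linarith) ?_
          rw [div_pow, mul_one_div, ← mul_div_assoc]
          gcongr
        have h4 : (Gamma (x + (k + 1 : ℕ)))⁻¹ = (Gamma (x + k))⁻¹ * (x + k)⁻¹ := by
          rw [one_div_Gamma_eq_self_mul_one_div_Gamma_add_one (x + k)]
          push_cast
          rw [← add_assoc]
          field_simp
        rw [h4, norm_mul, sum_range_succ, sum_range_succ, Nat.factorial_succ]
        refine (mul_le_mul ih h3 (norm_nonneg _) (by positivity)).trans (le_of_eq ?_)
        rw [mul_assoc, mul_mul_mul_comm, ← Real.exp_add]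
        push_cast
        rw [mul_inv]
        ring_nf
  refine h1.trans ?_
  have h4 : |1 - x.re| ≤ M + 1 := (abs_sub _ _).trans (by
    rw [abs_one]; linarith)
  have h6 := mul_harmonic_le h4 k
  have h5 := sum_inv_sq_le k
  rw [mul_assoc B', mul_left_comm (Real.exp _)]
  gcongr
  rw [Real.rpow_def_of_pos (by positivity), ← Real.exp_add]
  refine Real.exp_le_exp.2 ?_
  nlinarith [sq_nonneg (M + 1)]

lemma tendsto_poch_div {x : ℂ} (hx : ∀ m : ℕ, x ≠ -m) :
    Tendsto (fun k : ℕ => poch x k / (k.factorial * (k : ℂ) ^ (x - 1))) atTop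
      (𝓝 (Gamma x)⁻¹) := by
  have h := (GammaSeq_tendsto_Gamma x).inv₀ (Gamma_ne_zero hx)
  have h2 : Tendsto (fun k : ℕ => ((k : ℂ) / (k + x))) atTop (𝓝 1) := by
    simpa using tendsto_natCast_div_add_atTop x
  have h3 := h.mul h2
  rw [mul_one] at h3
  refine h3.congr' ?_
  filter_upwards [eventually_ne_atTop 0] with k hk
  have hk' : (k : ℂ) ≠ 0 := by exact_mod_cast hk
  have e1 : (k : ℂ) ^ x ≠ 0 := by simp [cpow_eq_zero_iff, hk']
  have e2 : (k.factorial : ℂ) ≠ 0 := by exact_mod_cast k.factorial_ne_zero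
  have e3 : (k : ℂ) + x ≠ 0 := by
    intro h0
    exact hx k (eq_neg_of_add_eq_zero_right h0)
  have e4 := poch_ne_zero hx k
  rw [GammaSeq, ← poch, poch_succ, cpow_sub _ _ hk', cpow_one, add_comm x]
  field_simp

lemma tendsto_Gamma_div {x : ℂ} (hx : ∀ m : ℕ, x ≠ -m) :
    Tendsto (fun k : ℕ => Gamma (x + k) / (k.factorial * (k : ℂ) ^ (x - 1))) atTop
      (𝓝 1) := by
  have h := (tendsto_poch_div hx).mul_const (Gamma x)
  rw [inv_mul_cancel₀ (Gamma_ne_zero hx)] at h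
  refine h.congr fun k => ?_
  rw [Gamma_add_nat hx]
  ring

lemma exists_norm_Gamma_le {x : ℂ} (hx : ∀ m : ℕ, x ≠ -m) : ∃ K : ℝ, 0 < K ∧ ∀ k : ℕ,
    ‖Gamma (x + k)‖ ≤ K * (k.factorial * ((k : ℝ) + 1) ^ (x.re - 1)) := by
  obtain ⟨K, hK, h⟩ := exists_norm_poch_le ‖x‖
  have h0 := Gamma_ne_zero hx
  refine ⟨‖Gamma x‖ * K, by positivity, fun k => ?_⟩
  rw [Gamma_add_nat hx, norm_mul, mul_comm ‖poch x k‖, mul_assoc]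
  gcongr
  exact h x le_rfl k

lemma summable_succ_rpow {p : ℝ} (hp : p < -1) : Summable fun k : ℕ => ((k : ℝ) + 1) ^ p := by
  have := (summable_nat_add_iff 1).2 (Real.summable_nat_rpow.2 hp)
  simpa using this

/-- The general term of the regularized series `Phi`. -/
def phiTerm (a b c d e f g : ℂ) (k : ℕ) : ℂ :=
  poch a k * poch b k * poch c k * poch d k * (k.factorial : ℂ)⁻¹ *
    (Gamma (e + k))⁻¹ * (Gamma (f + k))⁻¹ * (Gamma (g + k))⁻¹

/-- The hypergeometric series `₄F₃(a,b,c,d;e,f,g;1)` divided by `Γ(e)Γ(f)Γ(g)`. -/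
def Phi (a b c d e f g : ℂ) : ℂ := ∑' k, phiTerm a b c d e f g k

lemma exists_norm_phiTerm_le (M : ℝ) : ∃ K : ℝ, 0 < K ∧ ∀ a b c d e f g : ℂ,
    e + f + g = a + b + c + d + 1 → ‖a‖ ≤ M → ‖b‖ ≤ M → ‖c‖ ≤ M → ‖d‖ ≤ M → ‖e‖ ≤ M →
    ‖f‖ ≤ M → ‖g‖ ≤ M → ∀ k : ℕ, ‖phiTerm a b c d e f g k‖ ≤ K * ((k : ℝ) + 1) ^ (-2 : ℝ) := by
  obtain ⟨K, hK, h⟩ := exists_norm_poch_le M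
  obtain ⟨L, hL, h'⟩ := exists_norm_inv_Gamma_le M
  refine ⟨K ^ 4 * L ^ 3, by positivity, fun a b c d e f g hbal ha hb hc hd he hf hg k => ?_⟩
  have hk' : (0 : ℝ) < (k : ℝ) + 1 := by positivity
  have hfac : (0 : ℝ) < k.factorial := by positivity
  have hre := congrArg re hbal
  simp at hre
  calc ‖phiTerm a b c d e f g k‖
      = ‖poch a k‖ * ‖poch b k‖ * ‖poch c k‖ * ‖poch d k‖ * (k.factorial : ℝ)⁻¹ *
        ‖(Gamma (e + k))⁻¹‖ * ‖(Gamma (f + k))⁻¹‖ * ‖(Gamma (g + k))⁻¹‖ := by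
        simp [phiTerm]
    _ ≤ (K * (k.factorial * ((k : ℝ) + 1) ^ (a.re - 1))) *
        (K * (k.factorial * ((k : ℝ) + 1) ^ (b.re - 1))) *
        (K * (k.factorial * ((k : ℝ) + 1) ^ (c.re - 1))) *
        (K * (k.factorial * ((k : ℝ) + 1) ^ (d.re - 1))) * (k.factorial : ℝ)⁻¹ *
        (L * ((k.factorial : ℝ)⁻¹ * ((k : ℝ) + 1) ^ (1 - e.re))) *
        (L * ((k.factorial : ℝ)⁻¹ * ((k : ℝ) + 1) ^ (1 - f.re))) *
        (L * ((k.factorial : ℝ)⁻¹ * ((k : ℝ) + 1) ^ (1 - g.re))) := by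
        gcongr
        exacts [h a ha k, h b hb k, h c hc k, h d hd k, h' e he k, h' f hf k, h' g hg k]
    _ = K ^ 4 * L ^ 3 * (((k : ℝ) + 1) ^ (a.re - 1) * ((k : ℝ) + 1) ^ (b.re - 1) *
        ((k : ℝ) + 1) ^ (c.re - 1) * ((k : ℝ) + 1) ^ (d.re - 1) * ((k : ℝ) + 1) ^ (1 - e.re) *
        ((k : ℝ) + 1) ^ (1 - f.re) * ((k : ℝ) + 1) ^ (1 - g.re)) := by
        field_simp
    _ = K ^ 4 * L ^ 3 * ((k : ℝ) + 1) ^ (-2 : ℝ) := by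
        simp only [← Real.rpow_add hk']
        congr 2
        linarith

lemma differentiable_poch (k : ℕ) : Differentiable ℂ fun x => poch x k := by
  unfold poch
  fun_prop

lemma differentiable_Phi {a b c d e f g : ℂ → ℂ} (ha : Differentiable ℂ a)
    (hb : Differentiable ℂ b) (hc : Differentiable ℂ c) (hd : Differentiable ℂ d)
    (he : Differentiable ℂ e) (hf : Differentiable ℂ f) (hg : Differentiable ℂ g)
    (h : ∀ z, e z + f z + g z = a z + b z + c z + d z + 1) :
    Differentiable ℂ fun z => Phi (a z) (b z) (c z) (d z) (e z) (f z) (g z) := by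
  intro z₀
  have bdd : ∀ u : ℂ → ℂ, Differentiable ℂ u → ∃ M, ∀ z ∈ Metric.closedBall z₀ 1, ‖u z‖ ≤ M :=
    fun u hu => (isCompact_closedBall z₀ 1).exists_bound_of_continuousOn hu.continuous.continuousOn
  obtain ⟨Ma, hMa⟩ := bdd a ha
  obtain ⟨Mb, hMb⟩ := bdd b hb
  obtain ⟨Mc, hMc⟩ := bdd c hc
  obtain ⟨Md, hMd⟩ := bdd d hd
  obtain ⟨Me, hMe⟩ := bdd e he
  obtain ⟨Mf, hMf⟩ := bdd f hf
  obtain ⟨Mg, hMg⟩ := bdd g hg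
  obtain ⟨K, -, hK⟩ := exists_norm_phiTerm_le
    (|Ma| + |Mb| + |Mc| + |Md| + |Me| + |Mf| + |Mg|)
  have hterm : ∀ k, Differentiable ℂ fun z =>
      phiTerm (a z) (b z) (c z) (d z) (e z) (f z) (g z) k := by
    intro k
    have hp (u : ℂ → ℂ) (hu : Differentiable ℂ u) : Differentiable ℂ fun z => poch (u z) k :=
      (differentiable_poch k).comp hu
    have hq (u : ℂ → ℂ) (hu : Differentiable ℂ u) :
        Differentiable ℂ fun z => (Gamma (u z + k))⁻¹ :=
      differentiable_one_div_Gamma.comp (hu.add_const _)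
    exact ((((((((hp a ha).mul (hp b hb)).mul (hp c hc)).mul (hp d hd)).mul_const _).mul
      (hq e he)).mul (hq f hf)).mul (hq g hg))
  have := differentiableOn_tsum_of_summable_norm
    ((summable_succ_rpow (by norm_num : (-2 : ℝ) < -1)).mul_left K)
    (fun k => (hterm k).differentiableOn) (Metric.isOpen_ball (x := z₀) (ε := 1))
    (fun k z hz => by
      have hz' := Metric.ball_subset_closedBall hz
      have := abs_nonneg Ma
      have := abs_nonneg Mb
      have := abs_nonneg Mc
      have := abs_nonneg Md
      have := abs_nonneg Me
      have := abs_nonneg Mf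
      have := abs_nonneg Mg
      refine hK _ _ _ _ _ _ _ (h z) ?_ ?_ ?_ ?_ ?_ ?_ ?_ k
      · linarith [hMa z hz', le_abs_self Ma]
      · linarith [hMb z hz', le_abs_self Mb]
      · linarith [hMc z hz', le_abs_self Mc]
      · linarith [hMd z hz', le_abs_self Md]
      · linarith [hMe z hz', le_abs_self Me]
      · linarith [hMf z hz', le_abs_self Mf]
      · linarith [hMg z hz', le_abs_self Mg])
  exact this.differentiableAt (Metric.ball_mem_nhds z₀ one_pos)

lemma Phi_swap_bc (a b c d e f g : ℂ) : Phi a b c d e f g = Phi a c b d e f g :=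
  tsum_congr fun k => by simp only [phiTerm]; ring

/-- The antisymmetrization of `Phi` whose quotient by `sin (π e)` is `Lf`. -/
def Lnum (a b c d e f g : ℂ) : ℂ :=
  Phi a b c d e f g * (Gamma (1 + a - e))⁻¹ * (Gamma (1 + b - e))⁻¹ * (Gamma (1 + c - e))⁻¹ *
      (Gamma (1 + d - e))⁻¹ -
    Phi (1 + a - e) (1 + b - e) (1 + c - e) (1 + d - e) (2 - e) (1 + f - e) (1 + g - e) *
      (Gamma a)⁻¹ * (Gamma b)⁻¹ * (Gamma c)⁻¹ * (Gamma d)⁻¹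

lemma differentiable_Lnum {a b c d e f g : ℂ → ℂ} (ha : Differentiable ℂ a)
    (hb : Differentiable ℂ b) (hc : Differentiable ℂ c) (hd : Differentiable ℂ d)
    (he : Differentiable ℂ e) (hf : Differentiable ℂ f) (hg : Differentiable ℂ g)
    (h : ∀ z, e z + f z + g z = a z + b z + c z + d z + 1) :
    Differentiable ℂ fun z => Lnum (a z) (b z) (c z) (d z) (e z) (f z) (g z) := by
  have hq {u : ℂ → ℂ} (hu : Differentiable ℂ u) : Differentiable ℂ fun z => (Gamma (u z))⁻¹ :=
    differentiable_one_div_Gamma.comp hu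
  have hs {u : ℂ → ℂ} (hu : Differentiable ℂ u) : Differentiable ℂ fun z => 1 + u z - e z :=
    (hu.const_add 1).sub he
  have h1 := differentiable_Phi ha hb hc hd he hf hg h
  have h2 := differentiable_Phi (hs ha) (hs hb) (hs hc) (hs hd) (he.const_sub 2) (hs hf) (hs hg)
    (fun z => by linear_combination h z)
  exact ((((h1.mul (hq (hs ha))).mul (hq (hs hb))).mul (hq (hs hc))).mul (hq (hs hd))).sub
    ((((h2.mul (hq ha)).mul (hq hb)).mul (hq hc)).mul (hq hd))

lemma tsum_eq_of_telescope {f G : ℕ → ℂ} {l : ℂ} (hf : Summable f)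
    (h : ∀ n, f n = G (n + 1) - G n) (hG : Tendsto G atTop (𝓝 l)) : ∑' n, f n = l - G 0 := by
  refine tendsto_nhds_unique hf.hasSum.tendsto_sum_nat ?_
  simp only [h, sum_range_sub]
  exact hG.sub_const _

lemma tendsto_poch_ratio_mul_cpow {x y u v s : ℂ} (hx : ∀ m : ℕ, x ≠ -m)
    (hy : ∀ m : ℕ, y ≠ -m) (hu : ∀ m : ℕ, u ≠ -m) (hv : ∀ m : ℕ, v ≠ -m)
    (h : x + y + s = u + v) :
    Tendsto (fun n : ℕ => poch x n * poch y n / (poch u n * poch v n) * (n : ℂ) ^ s) atTop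
      (𝓝 (Gamma u * Gamma v / (Gamma x * Gamma y))) := by
  have h1 := ((tendsto_poch_div hx).mul (tendsto_poch_div hy)).div
    ((tendsto_poch_div hu).mul (tendsto_poch_div hv))
    (mul_ne_zero (inv_ne_zero (Gamma_ne_zero hu)) (inv_ne_zero (Gamma_ne_zero hv)))
  have e : (Gamma x)⁻¹ * (Gamma y)⁻¹ / ((Gamma u)⁻¹ * (Gamma v)⁻¹) =
      Gamma u * Gamma v / (Gamma x * Gamma y) := by
    field_simp
  rw [e] at h1
  refine h1.congr' ?_
  filter_upwards [eventually_ne_atTop 0] with k hk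
  have hk' : (k : ℂ) ≠ 0 := by exact_mod_cast hk
  have e2 : (k.factorial : ℂ) ≠ 0 := by exact_mod_cast k.factorial_ne_zero
  have e1 (s : ℂ) : (k : ℂ) ^ s ≠ 0 := by simp [cpow_eq_zero_iff, hk']
  have e3 : (k : ℂ) ^ (x - 1) * (k : ℂ) ^ (y - 1) * (k : ℂ) ^ s =
      (k : ℂ) ^ (u - 1) * (k : ℂ) ^ (v - 1) := by
    rw [← cpow_add _ _ hk', ← cpow_add _ _ hk', ← cpow_add _ _ hk']
    congr 1
    linear_combination h
  have := e1 (x - 1)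
  have := e1 (y - 1)
  have := e1 (u - 1)
  have := e1 (v - 1)
  have := poch_ne_zero hu k
  have := poch_ne_zero hv k
  dsimp only [Pi.div_apply]
  generalize (k : ℂ) ^ (x - 1) = X at *
  generalize (k : ℂ) ^ (y - 1) = Y at *
  generalize (k : ℂ) ^ (u - 1) = U at *
  generalize (k : ℂ) ^ (v - 1) = V at *
  field_simp
  linear_combination -(poch x k * poch y k) * e3

lemma tendsto_poch_ratio {x y u v : ℂ} (hx : ∀ m : ℕ, x ≠ -m) (hy : ∀ m : ℕ, y ≠ -m)
    (hu : ∀ m : ℕ, u ≠ -m) (hv : ∀ m : ℕ, v ≠ -m) (h : x + y = u + v) :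
    Tendsto (fun n => poch x n * poch y n / (poch u n * poch v n)) atTop
      (𝓝 (Gamma u * Gamma v / (Gamma x * Gamma y))) := by
  simpa using tendsto_poch_ratio_mul_cpow hx hy hu hv (s := 0) (by simpa using h)

lemma norm_poch_ofReal_le {y : ℝ} (hy : 0 < y) {x : ℂ} (hx : y ≤ x.re) (n : ℕ) :
    ‖poch (y : ℂ) n‖ ≤ ‖poch x n‖ := by
  simp only [poch, norm_prod]
  refine prod_le_prod (fun _ _ => norm_nonneg _) fun j _ => ?_
  have : ((y : ℂ) + j) = ((y + j : ℝ) : ℂ) := by push_cast; rfl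
  rw [this, norm_real, Real.norm_of_nonneg (by positivity)]
  refine le_trans ?_ (re_le_norm _)
  simpa using hx

/-- The general term of Gauss's series `₂F₁(b,c;h;1) / Γ(h)`. -/
def gaussTerm (b c h : ℂ) (n : ℕ) : ℂ :=
  poch b n * poch c n * (n.factorial : ℂ)⁻¹ * (Gamma (h + n))⁻¹

lemma exists_norm_gaussTerm_le (b c h : ℂ) : ∃ K : ℝ, 0 < K ∧ ∀ n : ℕ,
    ‖gaussTerm b c h n‖ ≤ K * ((n : ℝ) + 1) ^ ((b + c - h).re - 1) := by
  obtain ⟨K, hK, hk⟩ := exists_norm_poch_le (‖b‖ + ‖c‖)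
  obtain ⟨L, hL, hl⟩ := exists_norm_inv_Gamma_le ‖h‖
  refine ⟨K ^ 2 * L, by positivity, fun n => ?_⟩
  have hn : (0 : ℝ) < (n : ℝ) + 1 := by positivity
  have hfac : (0 : ℝ) < n.factorial := by positivity
  calc ‖gaussTerm b c h n‖
      = ‖poch b n‖ * ‖poch c n‖ * (n.factorial : ℝ)⁻¹ * ‖(Gamma (h + n))⁻¹‖ := by
        simp [gaussTerm]
    _ ≤ (K * (n.factorial * ((n : ℝ) + 1) ^ (b.re - 1))) *
        (K * (n.factorial * ((n : ℝ) + 1) ^ (c.re - 1))) * (n.factorial : ℝ)⁻¹ *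
        (L * ((n.factorial : ℝ)⁻¹ * ((n : ℝ) + 1) ^ (1 - h.re))) := by
        gcongr
        exacts [hk b (by linarith [norm_nonneg c]) n, hk c (by linarith [norm_nonneg b]) n,
          hl h le_rfl n]
    _ = K ^ 2 * L * (((n : ℝ) + 1) ^ (b.re - 1) * ((n : ℝ) + 1) ^ (c.re - 1) *
        ((n : ℝ) + 1) ^ (1 - h.re)) := by
        field_simp
    _ = _ := by
        simp only [← Real.rpow_add hn]
        congr 2
        simp
        ring

lemma summable_norm_gaussTerm {b c h : ℂ} (hre : 0 < (h - b - c).re) :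
    Summable fun n => ‖gaussTerm b c h n‖ := by
  obtain ⟨K, -, hK⟩ := exists_norm_gaussTerm_le b c h
  refine Summable.of_nonneg_of_le (fun _ => norm_nonneg _) hK
    ((summable_succ_rpow ?_).mul_left K)
  simp at hre ⊢
  linarith

lemma gaussTerm_succ (b c h : ℂ) (n : ℕ) :
    (n + 1) * gaussTerm b c h (n + 1) = (b + n) * (c + n) * gaussTerm b c (h + 1) n := by
  have h1 : ((n : ℂ) + 1) ≠ 0 := by exact_mod_cast n.succ_ne_zero
  have h2 : h + ((n + 1 : ℕ) : ℂ) = h + 1 + n := by push_cast; ring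
  simp only [gaussTerm, poch_succ, Nat.factorial_succ, h2]
  push_cast
  field_simp

lemma gaussTerm_add_one (b c h : ℂ) (n : ℕ) :
    gaussTerm b c h n = (h + n) * gaussTerm b c (h + 1) n := by
  simp only [gaussTerm]
  rw [one_div_Gamma_eq_self_mul_one_div_Gamma_add_one (h + n), add_right_comm]
  ring

lemma tsum_gaussTerm_add_one {b c h : ℂ} (hre : 0 < (h - b - c).re) :
    (h - b - c) * ∑' n, gaussTerm b c h n =
      (h - b) * (h - c) * ∑' n, gaussTerm b c (h + 1) n := by
  have s0 := (summable_norm_gaussTerm hre).of_norm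
  have s1 : Summable (gaussTerm b c (h + 1)) := (summable_norm_gaussTerm (by
    simp at hre ⊢; linarith)).of_norm
  have hG : Tendsto (fun n : ℕ => (n : ℂ) * gaussTerm b c h n) atTop (𝓝 0) := by
    obtain ⟨K, hK0, hK⟩ := exists_norm_gaussTerm_le b c h
    refine squeeze_zero_norm (a := fun n : ℕ => K * ((n : ℝ) + 1) ^ (-(h - b - c).re)) ?_ ?_
    · intro n
      have hn : (0 : ℝ) < (n : ℝ) + 1 := by positivity
      rw [norm_mul, Complex.norm_natCast]
      calc (n : ℝ) * ‖gaussTerm b c h n‖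
          ≤ ((n : ℝ) + 1) * (K * ((n : ℝ) + 1) ^ ((b + c - h).re - 1)) := by
            gcongr
            · linarith
            · exact hK n
        _ = K * (((n : ℝ) + 1) * ((n : ℝ) + 1) ^ ((b + c - h).re - 1)) := by ring
        _ = _ := by
            rw [← Real.rpow_one_add' hn.le]
            · congr 2
              simp
              ring
            · simp at hre ⊢
              linarith
    · have := ((tendsto_rpow_neg_atTop hre).comp
        (tendsto_natCast_atTop_atTop.atTop_add tendsto_const_nhds (C := (1 : ℝ)))).const_mul K
      simpa using this
  have := tsum_eq_of_telescope (f := fun n => (h - b) * (h - c) * gaussTerm b c (h + 1) n -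
    (h - b - c) * gaussTerm b c h n) ((s1.mul_left _).sub (s0.mul_left _)) (fun n => by
      push_cast
      rw [gaussTerm_succ, gaussTerm_add_one b c h n]
      ring) hG
  rw [(s1.mul_left _).tsum_sub (s0.mul_left _), tsum_mul_left, tsum_mul_left] at this
  simp at this
  linear_combination -this

lemma tsum_gaussTerm_iterate {b c h : ℂ} (hre : 0 < (h - b - c).re) (N : ℕ) :
    poch (h - b - c) N * ∑' n, gaussTerm b c h n =
      poch (h - b) N * poch (h - c) N * ∑' n, gaussTerm b c (h + N) n := by
  induction N with
  | zero => simp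
  | succ N ih =>
    have := tsum_gaussTerm_add_one (b := b) (c := c) (h := h + N) (by
      simp at hre ⊢; linarith [(Nat.cast_nonneg N : (0 : ℝ) ≤ N)])
    rw [poch_succ, poch_succ, poch_succ]
    push_cast
    rw [← add_assoc]
    linear_combination (h - b - c + N) * ih + poch (h - b) N * poch (h - c) N * this

lemma tendsto_inv_add_natCast (x : ℂ) : Tendsto (fun N : ℕ => (x + N)⁻¹) atTop (𝓝 0) := by
  have h := (tendsto_natCast_div_add_atTop x).mul (tendsto_inv_atTop_nhds_zero_nat (𝕜 := ℂ))
  rw [mul_zero] at h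
  refine h.congr' ?_
  filter_upwards [eventually_ne_atTop 0] with N hN
  have : (N : ℂ) ≠ 0 := by exact_mod_cast hN
  rw [add_comm x]
  field_simp

lemma tendsto_inv_poch_add_natCast (x : ℂ) (n : ℕ) :
    Tendsto (fun N : ℕ => (poch (x + N) n)⁻¹) atTop (𝓝 (∏ _j ∈ range n, 0)) := by
  simp only [poch, ← prod_inv_distrib]
  refine tendsto_finsetProd _ fun j _ => ?_
  refine (tendsto_inv_add_natCast (x + j)).congr fun N => ?_
  rw [add_right_comm]

/-- Gauss's summation theorem. -/
lemma tsum_gaussTerm {b c h : ℂ} (hre : 0 < (h - b - c).re) (hh : ∀ m : ℕ, h ≠ -m)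
    (hb : ∀ m : ℕ, h - b ≠ -m) (hc : ∀ m : ℕ, h - c ≠ -m) :
    ∑' n, gaussTerm b c h n = Gamma (h - b - c) / (Gamma (h - b) * Gamma (h - c)) := by
  have hd := ne_neg_nat_of_re_pos hre
  have key : Tendsto (fun N : ℕ => poch h N * ∑' n, gaussTerm b c (h + N) n) atTop
      (𝓝 (Gamma h)⁻¹) := by
    have e1 (N n : ℕ) (hN : ∀ m : ℕ, h + N ≠ -m) : poch h N * gaussTerm b c (h + N) n =
        (Gamma h)⁻¹ * (poch b n * poch c n * (n.factorial : ℂ)⁻¹ * (poch (h + N) n)⁻¹) := by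
      rw [gaussTerm, inv_Gamma_eq h N, inv_Gamma_eq (h + N) n]
      have := poch_ne_zero hN n
      field_simp
    obtain ⟨y, hy0, hy⟩ : ∃ y : ℝ, 0 < y ∧ (b + c).re < y :=
      ⟨|(b + c).re| + 1, by positivity, by linarith [le_abs_self (b + c).re]⟩
    have hyn : ∀ m : ℕ, (y : ℂ) ≠ -m := ne_neg_nat_of_re_pos (by simpa using hy0)
    have hlarge : ∀ᶠ N : ℕ in atTop, y ≤ (h + N).re := by
      filter_upwards [tendsto_natCast_atTop_atTop.eventually_ge_atTop (y - h.re)] with N hN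
      simp
      linarith
    have hlim : ∑' n, (Gamma h)⁻¹ * (poch b n * poch c n * (n.factorial : ℂ)⁻¹ *
        ∏ _j ∈ range n, 0) = (Gamma h)⁻¹ := by
      rw [tsum_eq_single 0]
      · simp
      · intro n hn
        simp [hn]
    rw [← hlim]
    simp only [← tsum_mul_left]
    refine tendsto_tsum_of_dominated_convergence
      (bound := fun n => ‖(Gamma h)⁻¹ * Gamma y‖ * ‖gaussTerm b c y n‖)
      ((summable_norm_gaussTerm ?_).mul_left _) (fun n => ?_) ?_
    · simp at hy ⊢
      linarith
    · refine (((tendsto_inv_poch_add_natCast h n).const_mul _).const_mul _).congr' ?_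
      filter_upwards [hlarge] with N hN
      rw [e1 N n (ne_neg_nat_of_re_pos (hy0.trans_le hN))]
    · filter_upwards [hlarge] with N hN n
      have hN' := ne_neg_nat_of_re_pos (hy0.trans_le hN)
      rw [e1 N n hN']
      have e2 : gaussTerm b c y n * Gamma y =
          poch b n * poch c n * (n.factorial : ℂ)⁻¹ * (poch (y : ℂ) n)⁻¹ := by
        rw [gaussTerm, Gamma_add_nat hyn]
        have := Gamma_ne_zero hyn
        field_simp
      rw [← norm_mul, mul_assoc (Gamma h)⁻¹, mul_comm (Gamma y), e2]
      simp only [norm_mul, norm_inv]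
      have := norm_poch_ofReal_le hy0 hN n
      have : 0 < ‖poch (y : ℂ) n‖ := norm_pos_iff.2 (poch_ne_zero hyn n)
      gcongr
  have h1 := (tendsto_poch_ratio hd hh hb hc (by ring)).mul_const (∑' n, gaussTerm b c h n)
  have h2 := tendsto_nhds_unique h1 (key.congr fun N => by
    have e := tsum_gaussTerm_iterate hre N
    have := poch_ne_zero hb N
    have := poch_ne_zero hc N
    field_simp
    linear_combination -poch h N * e)
  have := Gamma_ne_zero hh
  have := Gamma_ne_zero hb
  have := Gamma_ne_zero hc
  have := Gamma_ne_zero hd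
  field_simp at h2 ⊢
  linear_combination h2

/-- The general term of `Γ(a)/(Γ(e)Γ(C+a)) · ₃F₂(a,b,c;e,C+a;1)`. -/
def saalTerm (a b c e C : ℂ) (k : ℕ) : ℂ :=
  gaussTerm b c e k * (Gamma (a + k) * (Gamma (C + a + k))⁻¹)

lemma exists_norm_Gamma_ratio_le {a h : ℂ} (ha : ∀ m : ℕ, a ≠ -m) : ∃ K : ℝ, 0 < K ∧
    ∀ k : ℕ, ‖Gamma (a + k) * (Gamma (h + k))⁻¹‖ ≤ K * ((k : ℝ) + 1) ^ ((a - h).re) := by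
  obtain ⟨K, hK, hk⟩ := exists_norm_Gamma_le ha
  obtain ⟨L, hL, hl⟩ := exists_norm_inv_Gamma_le ‖h‖
  refine ⟨K * L, by positivity, fun n => ?_⟩
  have hn : (0 : ℝ) < (n : ℝ) + 1 := by positivity
  have hfac : (0 : ℝ) < n.factorial := by positivity
  calc ‖Gamma (a + n) * (Gamma (h + n))⁻¹‖ = ‖Gamma (a + n)‖ * ‖(Gamma (h + n))⁻¹‖ := norm_mul _ _
    _ ≤ (K * (n.factorial * ((n : ℝ) + 1) ^ (a.re - 1))) *
        (L * ((n.factorial : ℝ)⁻¹ * ((n : ℝ) + 1) ^ (1 - h.re))) := by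
        gcongr
        exacts [hk n, hl h le_rfl n]
    _ = K * L * (((n : ℝ) + 1) ^ (a.re - 1) * ((n : ℝ) + 1) ^ (1 - h.re)) := by
        field_simp
    _ = _ := by
        simp only [← Real.rpow_add hn]
        congr 2
        simp

lemma exists_norm_saalTerm_le {a b c e C : ℂ} (he : e = 1 + b + c - C) (ha : ∀ m : ℕ, a ≠ -m) :
    ∃ K : ℝ, 0 < K ∧ ∀ k : ℕ, ‖saalTerm a b c e C k‖ ≤ K * ((k : ℝ) + 1) ^ (-2 : ℝ) := by
  obtain ⟨K, hK, hk⟩ := exists_norm_gaussTerm_le b c e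
  obtain ⟨L, hL, hl⟩ := exists_norm_Gamma_ratio_le (h := C + a) ha
  refine ⟨K * L, by positivity, fun n => ?_⟩
  have hn : (0 : ℝ) < (n : ℝ) + 1 := by positivity
  rw [saalTerm, norm_mul]
  refine (mul_le_mul (hk n) (hl n) (norm_nonneg _) (by positivity)).trans (le_of_eq ?_)
  rw [mul_mul_mul_comm, ← Real.rpow_add hn]
  congr 2
  subst he
  simp
  ring

lemma summable_norm_saalTerm {a b c e C : ℂ} (he : e = 1 + b + c - C) (ha : ∀ m : ℕ, a ≠ -m) :
    Summable fun k => ‖saalTerm a b c e C k‖ := by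
  obtain ⟨K, -, hK⟩ := exists_norm_saalTerm_le he ha
  exact Summable.of_nonneg_of_le (fun _ => norm_nonneg _) hK
    ((summable_succ_rpow (by norm_num)).mul_left K)

lemma tendsto_Gamma_ratio {a h : ℂ} (ha : ∀ m : ℕ, a ≠ -m) (hh : ∀ m : ℕ, h ≠ -m) :
    Tendsto (fun k : ℕ => Gamma (a + k) * (Gamma (h + k))⁻¹ * (k : ℂ) ^ (h - a)) atTop
      (𝓝 1) := by
  have h1 := (tendsto_Gamma_div ha).div (tendsto_Gamma_div hh) one_ne_zero
  rw [div_one] at h1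
  refine h1.congr' ?_
  filter_upwards [eventually_ne_atTop 0] with k hk
  have hk' : (k : ℂ) ≠ 0 := by exact_mod_cast hk
  have e2 : (k.factorial : ℂ) ≠ 0 := by exact_mod_cast k.factorial_ne_zero
  have e1 (s : ℂ) : (k : ℂ) ^ s ≠ 0 := by simp [cpow_eq_zero_iff, hk']
  have e3 : (k : ℂ) ^ (h - 1) = (k : ℂ) ^ (a - 1) * (k : ℂ) ^ (h - a) := by
    rw [← cpow_add _ _ hk']
    congr 1
    ring
  dsimp only [Pi.div_apply]
  rw [e3]
  have := e1 (a - 1)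
  have := e1 (h - a)
  generalize (k : ℂ) ^ (h - a) = X at *
  generalize (k : ℂ) ^ (a - 1) = Y at *
  by_cases h0 : Gamma (h + k) = 0
  · simp [h0]
  field_simp

lemma tendsto_gaussTerm_mul_cpow {b c e : ℂ} (hb : ∀ m : ℕ, b ≠ -m) (hc : ∀ m : ℕ, c ≠ -m)
    (he : ∀ m : ℕ, e ≠ -m) : Tendsto (fun k : ℕ => gaussTerm b c e k * (k : ℂ) ^ (1 + e - b - c))
      atTop (𝓝 ((Gamma b)⁻¹ * (Gamma c)⁻¹)) := by
  have h1 := ((tendsto_poch_div hb).mul (tendsto_poch_div hc)).div (tendsto_Gamma_div he)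
    one_ne_zero
  rw [div_one] at h1
  refine h1.congr' ?_
  filter_upwards [eventually_ne_atTop 0] with k hk
  have hk' : (k : ℂ) ≠ 0 := by exact_mod_cast hk
  have e2 : (k.factorial : ℂ) ≠ 0 := by exact_mod_cast k.factorial_ne_zero
  have e1 (s : ℂ) : (k : ℂ) ^ s ≠ 0 := by simp [cpow_eq_zero_iff, hk']
  have e3 : (k : ℂ) ^ (e - 1) =
      (k : ℂ) ^ (b - 1) * (k : ℂ) ^ (c - 1) * (k : ℂ) ^ (1 + e - b - c) := by
    rw [← cpow_add _ _ hk', ← cpow_add _ _ hk']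
    congr 1
    ring
  dsimp only [Pi.div_apply]
  rw [e3, gaussTerm]
  have := e1 (b - 1)
  have := e1 (c - 1)
  have := e1 (1 + e - b - c)
  generalize (k : ℂ) ^ (b - 1) = X at *
  generalize (k : ℂ) ^ (c - 1) = Y at *
  generalize (k : ℂ) ^ (1 + e - b - c) = Z at *
  by_cases h0 : Gamma (e + k) = 0
  · simp [h0]
  field_simp

lemma tsum_saalTerm_add_one {a b c e C : ℂ} (he : e = 1 + b + c - C) (ha : ∀ m : ℕ, a ≠ -m)
    (hb : ∀ m : ℕ, b ≠ -m) (hc : ∀ m : ℕ, c ≠ -m) (hCa : ∀ m : ℕ, C + a ≠ -m)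
    (hee : ∀ n : ℤ, e ≠ n) :
    (C + a - b) * (C + a - c) * ∑' k, saalTerm (a + 1) b c e C k -
      a * (1 + a - e) * ∑' k, saalTerm a b c e C k = (Gamma b)⁻¹ * (Gamma c)⁻¹ := by
  have ha1 : ∀ m : ℕ, a + 1 ≠ -m := fun m h => ha (m + 1) (by
    push_cast
    linear_combination h)
  have s0 := (summable_norm_saalTerm he ha).of_norm
  have s1 := (summable_norm_saalTerm he ha1).of_norm
  have he1 : ∀ m : ℕ, e - 1 ≠ -m := ne_neg_nat_of_ne_int fun n h => hee (n + 1) (by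
    push_cast
    linear_combination h)
  have rec1 (k : ℕ) : (e - 1 + k) * gaussTerm b c e k = gaussTerm b c (e - 1) k := by
    have := gaussTerm_add_one b c (e - 1) k
    rw [this]
    ring_nf
  have hGam (k : ℕ) : Gamma (a + 1 + k) * (Gamma (C + (a + 1) + k))⁻¹ * (C + a + k) =
      (a + k) * (Gamma (a + k) * (Gamma (C + a + k))⁻¹) := by
    rw [add_right_comm a 1, Gamma_add_one (a + k) (fun h => ha k (eq_neg_of_add_eq_zero_left h)),
      one_div_Gamma_eq_self_mul_one_div_Gamma_add_one (C + a + k)]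
    ring_nf
  have hG : Tendsto (fun k : ℕ => (k : ℂ) * ((e - 1 + k) * saalTerm a b c e C k)) atTop
      (𝓝 ((Gamma b)⁻¹ * (Gamma c)⁻¹)) := by
    have h1 := (tendsto_gaussTerm_mul_cpow hb hc he1).mul (tendsto_Gamma_ratio ha hCa)
    rw [mul_one] at h1
    refine h1.congr' ?_
    filter_upwards [eventually_ne_atTop 0] with k hk
    have hk' : (k : ℂ) ≠ 0 := by exact_mod_cast hk
    have e3 : (k : ℂ) = (k : ℂ) ^ (1 + (e - 1) - b - c) * (k : ℂ) ^ (C + a - a) := by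
      rw [← cpow_add _ _ hk', he]
      ring_nf
      rw [cpow_one]
    rw [saalTerm, ← mul_assoc (e - 1 + k : ℂ), rec1]
    linear_combination (-gaussTerm b c (e - 1) k *
      (Gamma (a + k) * (Gamma (C + a + k))⁻¹)) * e3
  have := tsum_eq_of_telescope (f := fun k => (C + a - b) * (C + a - c) *
    saalTerm (a + 1) b c e C k - a * (1 + a - e) * saalTerm a b c e C k)
    ((s1.mul_left _).sub (s0.mul_left _)) (fun k => ?_) hG
  · rw [(s1.mul_left _).tsum_sub (s0.mul_left _), tsum_mul_left, tsum_mul_left] at this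
    simpa using this
  · have hCk : C + a + k ≠ 0 := fun h => hCa k (eq_neg_of_add_eq_zero_left h)
    have g1 : Gamma (a + 1 + k) * (Gamma (C + (a + 1) + k))⁻¹ =
      (a + k) * (Gamma (a + k) * (Gamma (C + a + k))⁻¹) / (C + a + k) := by
      rw [← hGam]
      field_simp
    have g2 : (e - 1 + (k + 1 : ℕ)) * gaussTerm b c e (k + 1) * (k + 1 : ℕ) =
        (b + k) * (c + k) * gaussTerm b c e k := by
      have h1 := gaussTerm_succ b c e k
      have h2 := gaussTerm_add_one b c e k
      push_cast
      linear_combination (e + k) * h1 - (b + k) * (c + k) * h2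
    have g3 : Gamma (a + (k + 1 : ℕ)) * (Gamma (C + a + (k + 1 : ℕ)))⁻¹ =
        Gamma (a + 1 + k) * (Gamma (C + (a + 1) + k))⁻¹ := by
      push_cast
      ring_nf
    have g4 : ((k + 1 : ℕ) : ℂ) * ((e - 1 + (k + 1 : ℕ)) * saalTerm a b c e C (k + 1)) =
        (b + k) * (c + k) * gaussTerm b c e k *
          (Gamma (a + 1 + k) * (Gamma (C + (a + 1) + k))⁻¹) := by
      rw [saalTerm, g3, ← g2]
      ring
    rw [g4, saalTerm, saalTerm, g1]
    generalize Gamma (a + k) * (Gamma (C + a + k))⁻¹ = X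
    generalize gaussTerm b c e k = Y
    field_simp
    rw [he]
    ring

lemma norm_poch_mul_factorial_le {x C : ℂ} (h : 1 ≤ (C + x).re) (k : ℕ) :
    ‖poch x k‖ * k.factorial ≤ ‖poch (‖C‖ + 1 : ℂ) k‖ * ‖poch (C + x) k‖ := by
  induction k with
  | zero => simp
  | succ k ih =>
    rw [poch_succ, poch_succ, poch_succ, norm_mul, norm_mul, norm_mul, Nat.factorial_succ]
    have h1 : (k : ℝ) + 1 ≤ ‖C + x + k‖ := by
      refine le_trans ?_ (re_le_norm _)
      simp at h ⊢
      linarith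
    have h2 : ‖x + k‖ ≤ ‖C + x + k‖ + ‖C‖ := by
      refine le_trans (le_of_eq ?_) (norm_sub_le _ _)
      congr 1
      ring
    have h3 : ‖(‖C‖ + 1 + k : ℂ)‖ = ‖C‖ + 1 + k := by
      have : (‖C‖ + 1 + k : ℂ) = ((‖C‖ + 1 + k : ℝ) : ℂ) := by push_cast; rfl
      rw [this, norm_real, Real.norm_of_nonneg (by positivity)]
    have h4 : ‖x + k‖ * (k + 1) ≤ ‖(‖C‖ + 1 + k : ℂ)‖ * ‖C + x + k‖ := by
      rw [h3]
      nlinarith [norm_nonneg C, (Nat.cast_nonneg k : (0 : ℝ) ≤ k)]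
    push_cast
    calc ‖poch x k‖ * ‖x + k‖ * ((k + 1) * k.factorial)
        = (‖poch x k‖ * k.factorial) * (‖x + k‖ * (k + 1)) := by ring
      _ ≤ (‖poch (‖C‖ + 1 : ℂ) k‖ * ‖poch (C + x) k‖) *
          (‖(‖C‖ + 1 + k : ℂ)‖ * ‖C + x + k‖) := by gcongr
      _ = _ := by ring

lemma add_natCast_ne {x : ℂ} (hx : ∀ m : ℕ, x ≠ -m) (N m : ℕ) : x + N ≠ -m := fun h =>
  hx (N + m) (by push_cast; linear_combination h)

lemma tendsto_tsum_saalTerm {a b c e C : ℂ} (he : e = 1 + b + c - C) (hC : ‖C‖ + C.re < 1)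
    (ha : ∀ m : ℕ, a ≠ -m) (hCa : ∀ m : ℕ, C + a ≠ -m) (hee : ∀ m : ℕ, e ≠ -m)
    (heb : ∀ m : ℕ, e - b ≠ -m) (hec : ∀ m : ℕ, e - c ≠ -m) :
    Tendsto (fun N : ℕ => (∑' k, saalTerm (a + N) b c e C k) * (N : ℂ) ^ C) atTop
      (𝓝 (Gamma (1 - C) / (Gamma (e - b) * Gamma (e - c)))) := by
  have hre : 0 < (e - b - c).re := by
    have := abs_re_le_norm C
    rw [he]
    simp
    linarith [neg_abs_le C.re, le_abs_self C.re]
  have hG := tsum_gaussTerm hre hee heb hec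
  have h1 : e - b - c = 1 - C := by rw [he]; ring
  rw [h1] at hG
  rw [← hG]
  simp only [← tsum_mul_right]
  obtain ⟨K, hK0, hK⟩ := exists_norm_gaussTerm_le b c e
  obtain ⟨L, hL0, hL⟩ := exists_norm_poch_le ‖(‖C‖ + 1 : ℂ)‖
  have hR (k : ℕ) : Tendsto (fun N : ℕ =>
      Gamma (a + N + k) * (Gamma (C + (a + N) + k))⁻¹ * (N : ℂ) ^ C) atTop (𝓝 1) := by
    refine (tendsto_Gamma_ratio (add_natCast_ne ha k) (add_natCast_ne hCa k)).congr fun N => ?_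
    ring_nf
  have hb2 : ∀ᶠ N : ℕ in atTop,
      ‖Gamma (a + N) * (Gamma (C + (a + N)))⁻¹ * (N : ℂ) ^ C‖ ≤ 2 := by
    have := (hR 0).norm.eventually_le_const (u := 2) (by norm_num)
    simpa using this
  have hlarge : ∀ᶠ N : ℕ in atTop, 1 ≤ (C + (a + N)).re := by
    filter_upwards [tendsto_natCast_atTop_atTop.eventually_ge_atTop (1 - C.re - a.re)] with N hN
    simp
    linarith
  refine tendsto_tsum_of_dominated_convergence
    (bound := fun k => 2 * K * L * ((k : ℝ) + 1) ^ (‖C‖ + C.re - 2))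
    ((summable_succ_rpow (by linarith)).mul_left _) (fun k => ?_) ?_
  · have := (hR k).const_mul (gaussTerm b c e k)
    rw [mul_one] at this
    refine this.congr fun N => ?_
    rw [saalTerm]
    ring
  · filter_upwards [hb2, hlarge] with N h2 hN k
    have hk0 : (0 : ℝ) < (k : ℝ) + 1 := by positivity
    have hfac : (0 : ℝ) < k.factorial := by positivity
    have hp : ∀ m : ℕ, C + (a + N) ≠ -m := ne_neg_nat_of_re_pos (by linarith)
    have hp0 : 0 < ‖poch (C + (a + N)) k‖ := norm_pos_iff.2 (poch_ne_zero hp k)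
    have e1 : saalTerm (a + N) b c e C k * (N : ℂ) ^ C = gaussTerm b c e k *
        (Gamma (a + N) * (Gamma (C + (a + N)))⁻¹ * (N : ℂ) ^ C) *
        (poch (a + N) k * (poch (C + (a + N)) k)⁻¹) := by
      rw [saalTerm, Gamma_add_nat (add_natCast_ne ha N), Gamma_add_nat hp, mul_inv]
      ring
    have e2 : ‖poch (a + N) k * (poch (C + (a + N)) k)⁻¹‖ ≤ L * ((k : ℝ) + 1) ^ ‖C‖ := by
      rw [norm_mul, norm_inv, ← div_eq_mul_inv, div_le_iff₀ hp0]
      have g1 := norm_poch_mul_factorial_le hN k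
      have g2 := hL (‖C‖ + 1 : ℂ) le_rfl k
      have g3 : ((‖C‖ : ℂ) + 1).re - 1 = ‖C‖ := by simp
      rw [g3] at g2
      refine le_of_mul_le_mul_right (g1.trans ?_) hfac
      calc _ ≤ (L * (k.factorial * ((k : ℝ) + 1) ^ ‖C‖)) * ‖poch (C + (a + N)) k‖ := by gcongr
        _ = _ := by ring
    rw [e1, norm_mul, norm_mul]
    calc _ ≤ (K * ((k : ℝ) + 1) ^ ((b + c - e).re - 1)) * 2 * (L * ((k : ℝ) + 1) ^ ‖C‖) := by
          gcongr
          exact hK k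
      _ = 2 * K * L * (((k : ℝ) + 1) ^ ((b + c - e).re - 1) * ((k : ℝ) + 1) ^ ‖C‖) := by ring
      _ = _ := by
          rw [← Real.rpow_add hk0, he]
          congr 2
          simp
          ring

lemma inv_Gamma_mul_inv_Gamma_one_sub (x : ℂ) :
    (Gamma x)⁻¹ * (Gamma (1 - x))⁻¹ = Complex.sin (Real.pi * x) / Real.pi := by
  rw [← mul_inv, Complex.Gamma_mul_Gamma_one_sub, inv_div]

lemma sin_pi_mul_ne_zero_of_ne_int {x : ℂ} (hx : ∀ n : ℤ, x ≠ n) :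
    Complex.sin (Real.pi * x) ≠ 0 := by
  rw [Complex.sin_ne_zero_iff]
  intro n h
  refine hx n ?_
  have : (Real.pi : ℂ) ≠ 0 := by exact_mod_cast Real.pi_ne_zero
  apply mul_left_cancel₀ this
  linear_combination h

/-- The antisymmetric combination of two `₃F₂` series in the nonterminating Saalschütz theorem. -/
def saalZ (a b c e C : ℂ) : ℂ :=
  (∑' k, saalTerm a b c e C k) * ((Gamma (C - b))⁻¹ * (Gamma (C - c))⁻¹) -
    (∑' k, saalTerm (a + 1 - e) (C - b) (C - c) (2 - e) C k) * ((Gamma b)⁻¹ * (Gamma c)⁻¹)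

section

variable {a b c e C : ℂ} (he : e = 1 + b + c - C) (hee : ∀ n : ℤ, e ≠ n)
  (hb : ∀ n : ℤ, b ≠ n) (hc : ∀ n : ℤ, c ≠ n)
  (hCb : ∀ n : ℤ, C - b ≠ n) (hCc : ∀ n : ℤ, C - c ≠ n)
  (ha : ∀ m : ℕ, a ≠ -m) (hCa : ∀ m : ℕ, C + a ≠ -m) (ha' : ∀ m : ℕ, a + 1 - e ≠ -m)
  (hCa' : ∀ m : ℕ, C + (a + 1 - e) ≠ -m)

include he hee hb hc hCb hCc ha hCa ha' hCa'

lemma saalZ_add_one :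
    (C + a - b) * (C + a - c) * saalZ (a + 1) b c e C = a * (a + 1 - e) * saalZ a b c e C := by
  have h1 := tsum_saalTerm_add_one he ha (ne_neg_nat_of_ne_int hb) (ne_neg_nat_of_ne_int hc)
    hCa hee
  have h2 := tsum_saalTerm_add_one (a := a + 1 - e) (b := C - b) (c := C - c) (e := 2 - e) (C := C)
    (by rw [he]; ring) ha' (ne_neg_nat_of_ne_int hCb) (ne_neg_nat_of_ne_int hCc) hCa'
    (fun n h => hee (2 - n) (by push_cast; linear_combination -h))
  have h3 : a + 1 + 1 - e = a + 1 - e + 1 := by ring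
  have h4 : (C + (a + 1 - e) - (C - b)) = C + a - c := by rw [he]; ring
  have h5 : (C + (a + 1 - e) - (C - c)) = C + a - b := by rw [he]; ring
  have h6 : 1 + (a + 1 - e) - (2 - e) = a := by ring
  rw [h4, h5, h6] at h2
  rw [saalZ, saalZ, h3]
  linear_combination (Gamma (C - b))⁻¹ * (Gamma (C - c))⁻¹ * h1 - (Gamma b)⁻¹ * (Gamma c)⁻¹ * h2

lemma saalZ_iterate (N : ℕ) :
    poch (C + a - b) N * poch (C + a - c) N * saalZ (a + N) b c e C =
      poch a N * poch (a + 1 - e) N * saalZ a b c e C := by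
  induction N with
  | zero => simp
  | succ N ih =>
    have h := saalZ_add_one (a := a + N) he hee hb hc hCb hCc (add_natCast_ne ha N)
      (by rw [← add_assoc]; exact add_natCast_ne hCa N)
      (by rw [add_right_comm, add_sub_right_comm]; exact add_natCast_ne ha' N)
      (by rw [add_right_comm, add_sub_right_comm, ← add_assoc C]; exact add_natCast_ne hCa' N)
    simp only [poch_succ]
    push_cast
    rw [← add_assoc]
    linear_combination (a + N) * (a + 1 - e + N) * ih +
      poch (C + a - b) N * poch (C + a - c) N * h

/-- The nonterminating Saalschütz theorem. -/
lemma sin_mul_Gamma_eq_saalZ (hC : ‖C‖ + C.re < 1) (hCi : ∀ n : ℤ, C ≠ n)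
    (hCab : ∀ m : ℕ, C + a - b ≠ -m) (hCac : ∀ m : ℕ, C + a - c ≠ -m) :
    Gamma a * Gamma (a + 1 - e) * (Gamma (C + a - b))⁻¹ * (Gamma (C + a - c))⁻¹ *
      Complex.sin (Real.pi * e) = Real.pi * Gamma C * saalZ a b c e C := by
  have hpi : (Real.pi : ℂ) ≠ 0 := by exact_mod_cast Real.pi_ne_zero
  have hX := tendsto_tsum_saalTerm he hC ha hCa (ne_neg_nat_of_ne_int hee)
    (ne_neg_nat_of_ne_int fun n h => hCc (1 - n) (by push_cast; rw [he] at h; linear_combination -h))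
    (ne_neg_nat_of_ne_int fun n h => hCb (1 - n) (by push_cast; rw [he] at h; linear_combination -h))
  have hY := tendsto_tsum_saalTerm (a := a + 1 - e) (b := C - b) (c := C - c) (e := 2 - e) (C := C)
    (by rw [he]; ring) hC ha' hCa'
    (ne_neg_nat_of_ne_int fun n h => hee (2 - n) (by push_cast; linear_combination -h))
    (ne_neg_nat_of_ne_int fun n h => hc (1 - n) (by push_cast; rw [he] at h; linear_combination -h))
    (ne_neg_nat_of_ne_int fun n h => hb (1 - n) (by push_cast; rw [he] at h; linear_combination -h))
  have hZ := (hX.mul_const ((Gamma (C - b))⁻¹ * (Gamma (C - c))⁻¹)).sub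
    (hY.mul_const ((Gamma b)⁻¹ * (Gamma c)⁻¹))
  have hrat := tendsto_poch_ratio_mul_cpow (s := -C) hCab hCac ha ha' (by rw [he]; ring)
  have hprod := hrat.mul hZ
  have hlim : saalZ a b c e C = _ := tendsto_nhds_unique
    (tendsto_const_nhds (x := saalZ a b c e C) (f := (atTop : Filter ℕ))) (hprod.congr' (by
    filter_upwards [eventually_ne_atTop 0] with N hN
    have hN' : (N : ℂ) ≠ 0 := by exact_mod_cast hN
    have e1 : (N : ℂ) ^ (-C) * (N : ℂ) ^ C = 1 := by
      rw [← cpow_add _ _ hN']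
      simp
    have e2 := saalZ_iterate he hee hb hc hCb hCc ha hCa ha' hCa' N
    have e3 : a + N + 1 - e = a + 1 - e + N := by ring
    rw [saalZ, e3] at e2
    have := poch_ne_zero ha N
    have := poch_ne_zero ha' N
    rw [div_mul_eq_mul_div, div_mul_eq_mul_div, div_eq_iff (by positivity)]
    linear_combination e2 + (poch (C + a - b) N * poch (C + a - c) N) *
      ((∑' k, saalTerm (a + N) b c e C k) * ((Gamma (C - b))⁻¹ * (Gamma (C - c))⁻¹) -
      (∑' k, saalTerm (a + 1 - e + N) (C - b) (C - c) (2 - e) C k) *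
        ((Gamma b)⁻¹ * (Gamma c)⁻¹)) * e1))
  have r1 := inv_Gamma_mul_inv_Gamma_one_sub (C - b)
  have r2 := inv_Gamma_mul_inv_Gamma_one_sub (C - c)
  have r3 := inv_Gamma_mul_inv_Gamma_one_sub b
  have r4 := inv_Gamma_mul_inv_Gamma_one_sub c
  have r5 := Complex.Gamma_mul_Gamma_one_sub C
  have hs := sin_pi_mul_ne_zero_of_ne_int hCi
  have t1 : 2 - e - (C - b) = 1 - c := by rw [he]; ring
  have t2 : 2 - e - (C - c) = 1 - b := by rw [he]; ring
  have t3 : e - b = 1 - (C - c) := by rw [he]; ring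
  have t4 : e - c = 1 - (C - b) := by rw [he]; ring
  rw [t1, t2, t3, t4] at hlim
  have trig : Complex.sin (Real.pi * (C - b)) * Complex.sin (Real.pi * (C - c)) -
      Complex.sin (Real.pi * b) * Complex.sin (Real.pi * c) =
      Complex.sin (Real.pi * C) * Complex.sin (Real.pi * e) := by
    have h0 : (Real.pi * e : ℂ) = Real.pi - (Real.pi * C - Real.pi * b - Real.pi * c) := by
      rw [he]; ring
    rw [h0, Complex.sin_pi_sub]
    simp only [mul_sub, Complex.sin_sub, Complex.cos_sub]
    have c1 := Complex.sin_sq_add_cos_sq (Real.pi * C)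
    linear_combination (Complex.sin (Real.pi * b) * Complex.sin (Real.pi * c)) * c1
  have r12 : _ * _ = _ * _ := congrArg₂ (· * ·) r1 r2
  have r34 : _ * _ = _ * _ := congrArg₂ (· * ·) r3 r4
  have hB : Gamma (1 - C) / (Gamma (1 - (C - c)) * Gamma (1 - (C - b))) *
      ((Gamma (C - b))⁻¹ * (Gamma (C - c))⁻¹) -
      Gamma (1 - C) / (Gamma (1 - c) * Gamma (1 - b)) * ((Gamma b)⁻¹ * (Gamma c)⁻¹) =
      Gamma (1 - C) * (Complex.sin (Real.pi * C) * Complex.sin (Real.pi * e)) / Real.pi ^ 2 := by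
    rw [← trig]
    simp only [div_eq_mul_inv, mul_inv] at r12 r34 ⊢
    linear_combination Gamma (1 - C) * r12 - Gamma (1 - C) * r34
  rw [hlim, hB]
  rw [eq_div_iff hs] at r5
  simp only [div_eq_mul_inv, mul_inv]
  generalize Complex.sin (Real.pi * e) = s at *
  generalize Complex.sin (Real.pi * C) = t at *
  field_simp
  linear_combination -(Gamma a * Gamma (a + 1 - e) * (Gamma (C + a - b))⁻¹ *
    (Gamma (C + a - c))⁻¹ * s) * r5

end

/-- The Beta function `Γ(p)Γ(q)/Γ(p+q)`. -/
def eulerBeta (p q : ℂ) : ℂ := Gamma p * Gamma q * (Gamma (p + q))⁻¹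

lemma eulerBeta_add_one {p q : ℂ} (hp : p ≠ 0) (hq : q ≠ 0) :
    eulerBeta (p + 1) q = eulerBeta p q - eulerBeta p (q + 1) := by
  rw [eulerBeta, eulerBeta, eulerBeta, Gamma_add_one p hp, Gamma_add_one q hq,
    one_div_Gamma_eq_self_mul_one_div_Gamma_add_one (p + q), ← add_assoc, add_right_comm]
  ring

lemma exists_norm_eulerBeta_le {C a : ℂ} (hC : ∀ m : ℕ, C ≠ -m) : ∃ K : ℝ, 0 < K ∧
    ∀ N : ℕ, ‖eulerBeta (C + N) a‖ ≤ K * ((N : ℝ) + 1) ^ (-a.re) := by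
  obtain ⟨K, hK0, hK⟩ := exists_norm_Gamma_ratio_le (h := C + a) hC
  refine ⟨(‖Gamma a‖ + 1) * K, by positivity, fun N => ?_⟩
  have e1 : eulerBeta (C + N) a = Gamma a * (Gamma (C + N) * (Gamma (C + a + N))⁻¹) := by
    rw [eulerBeta, add_right_comm]
    ring
  rw [e1, norm_mul, mul_assoc]
  have h := hK N
  have e2 : (C - (C + a)).re = -a.re := by simp
  rw [e2] at h
  gcongr
  linarith

/-- The coefficients of `₂F₁(b,c;C;x)`. -/
def hypCoeff (b c C : ℂ) (n : ℕ) : ℂ :=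
  poch b n * poch c n * (n.factorial : ℂ)⁻¹ * (poch C n)⁻¹

lemma exists_norm_hypCoeff_le (b c : ℂ) {C : ℂ} (hC : ∀ m : ℕ, C ≠ -m) : ∃ K : ℝ, 0 < K ∧
    ∀ n : ℕ, ‖hypCoeff b c C n‖ ≤ K * ((n : ℝ) + 1) ^ ((b + c - C).re - 1) := by
  obtain ⟨K, hK0, hK⟩ := exists_norm_gaussTerm_le b c C
  refine ⟨(‖Gamma C‖ + 1) * K, by positivity, fun n => ?_⟩
  have h0 := Gamma_ne_zero hC
  have h1 := poch_ne_zero hC n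
  have e1 : hypCoeff b c C n = Gamma C * gaussTerm b c C n := by
    rw [hypCoeff, gaussTerm, Gamma_add_nat hC]
    field_simp
  rw [e1, norm_mul, mul_assoc]
  have h := hK n
  gcongr
  linarith

lemma summable_hypCoeff_mul_eulerBeta {b c C a : ℂ} (hC : ∀ m : ℕ, C ≠ -m) (ha : 0 < a.re)
    (hre : 0 < (C + a - b - c).re) (m : ℕ) :
    Summable fun n : ℕ => hypCoeff b c C n * eulerBeta (C + m + n) a := by
  obtain ⟨K, hK0, hK⟩ := exists_norm_hypCoeff_le b c hC
  obtain ⟨L, hL0, hL⟩ := exists_norm_eulerBeta_le (a := a) hC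
  refine Summable.of_norm_bounded (g := fun n : ℕ => K * L *
    ((n : ℝ) + 1) ^ ((b + c - C - a).re - 1)) ((summable_succ_rpow ?_).mul_left _) fun n => ?_
  · simp at hre ⊢
    linarith
  · have hn : (0 : ℝ) < (n : ℝ) + 1 := by positivity
    have h1 := hL (m + n)
    have h2 : (((m + n : ℕ) : ℝ) + 1) ^ (-a.re) ≤ ((n : ℝ) + 1) ^ (-a.re) := by
      refine Real.rpow_le_rpow_of_nonpos hn ?_ (by linarith)
      push_cast
      linarith [(Nat.cast_nonneg m : (0 : ℝ) ≤ m)]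
    push_cast at h1 h2
    rw [← add_assoc] at h1
    rw [norm_mul]
    calc _ ≤ (K * ((n : ℝ) + 1) ^ ((b + c - C).re - 1)) * (L * ((n : ℝ) + 1) ^ (-a.re)) := by
          gcongr
          · exact hK n
          · exact h1.trans (by gcongr)
      _ = K * L * (((n : ℝ) + 1) ^ ((b + c - C).re - 1) * ((n : ℝ) + 1) ^ (-a.re)) := by ring
      _ = _ := by
          rw [← Real.rpow_add hn]
          congr 2
          simp
          ring

lemma summable_gaussTerm_mul_eulerBeta {a b c e C : ℂ} (he : e = 1 + b + c - C)
    (ha : ∀ m : ℕ, a ≠ -m) (m : ℕ) :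
    Summable fun k : ℕ => gaussTerm b c e k * eulerBeta (C + m) (a + k) := by
  obtain ⟨K, hK0, hK⟩ := exists_norm_gaussTerm_le b c e
  obtain ⟨L, hL0, hL⟩ := exists_norm_Gamma_ratio_le (h := C + m + a) ha
  refine Summable.of_norm_bounded (g := fun n : ℕ => K * ‖Gamma (C + m)‖ * L *
    ((n : ℝ) + 1) ^ (-2 : ℝ)) ((summable_succ_rpow (by norm_num)).mul_left _) fun n => ?_
  have hn : (0 : ℝ) < (n : ℝ) + 1 := by positivity
  have e1 : eulerBeta (C + m) (a + n) =
      Gamma (C + m) * (Gamma (a + n) * (Gamma (C + m + a + n))⁻¹) := by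
    rw [eulerBeta, ← add_assoc]
    ring
  rw [e1, norm_mul, norm_mul]
  calc _ ≤ (K * ((n : ℝ) + 1) ^ ((b + c - e).re - 1)) * (‖Gamma (C + m)‖ *
        (L * ((n : ℝ) + 1) ^ ((a - (C + m + a)).re))) := by
        gcongr
        exacts [hK n, hL n]
    _ = K * ‖Gamma (C + m)‖ * L * (((n : ℝ) + 1) ^ ((b + c - e).re - 1) *
        ((n : ℝ) + 1) ^ ((a - (C + m + a)).re)) := by ring
    _ ≤ _ := by
        rw [← Real.rpow_add hn]
        gcongr
        · linarith [(Nat.cast_nonneg n : (0 : ℝ) ≤ n)]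
        · rw [he]
          simp
          linarith [(Nat.cast_nonneg m : (0 : ℝ) ≤ m)]

lemma tsum_gaussTerm_mul_eulerBeta_add_one {a b c e C : ℂ} (he : e = 1 + b + c - C)
    (ha : ∀ m : ℕ, a ≠ -m) (hC : ∀ m : ℕ, C ≠ -m) (m : ℕ) :
    ∑' k : ℕ, gaussTerm b c e k * eulerBeta (C + (m + 1 : ℕ)) (a + k) =
      ∑' k : ℕ, gaussTerm b c e k * eulerBeta (C + m) (a + k) -
      ∑' k : ℕ, gaussTerm b c e k * eulerBeta (C + m) (a + 1 + k) := by
  have ha1 : ∀ m : ℕ, a + 1 ≠ -m := by simpa using add_natCast_ne ha 1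
  rw [← (summable_gaussTerm_mul_eulerBeta he ha m).tsum_sub
    (summable_gaussTerm_mul_eulerBeta he ha1 m)]
  refine tsum_congr fun k => ?_
  push_cast
  rw [← add_assoc, eulerBeta_add_one (fun h => hC m (eq_neg_of_add_eq_zero_left h))
    (fun h => ha k (eq_neg_of_add_eq_zero_left h)), add_right_comm a]
  ring

lemma sin_mul_tsum_hypCoeff_mul_eulerBeta {b c e C : ℂ} (he : e = 1 + b + c - C)
    (hee : ∀ n : ℤ, e ≠ n) (hb : ∀ n : ℤ, b ≠ n) (hc : ∀ n : ℤ, c ≠ n)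
    (hCb : ∀ n : ℤ, C - b ≠ n) (hCc : ∀ n : ℤ, C - c ≠ n) (hC : ‖C‖ + C.re < 1)
    (hCi : ∀ n : ℤ, C ≠ n) (m : ℕ) {a : ℂ} (ha : 0 < a.re) (ha' : 0 < (a + 1 - e).re)
    (hCa : 0 < (C + a).re) (hCa' : 0 < (C + (a + 1 - e)).re)
    (hCab : 0 < (C + a - b).re) (hCac : 0 < (C + a - c).re) :
    Complex.sin (Real.pi * e) * ∑' n : ℕ, hypCoeff b c C n * eulerBeta (C + m + n) a =
      Real.pi * Gamma C *
      ((∑' k : ℕ, gaussTerm b c e k * eulerBeta (C + m) (a + k)) *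
          ((Gamma (C - b))⁻¹ * (Gamma (C - c))⁻¹) -
        (∑' k : ℕ, gaussTerm (C - b) (C - c) (2 - e) k * eulerBeta (C + m) (a + 1 - e + k)) *
          ((Gamma b)⁻¹ * (Gamma c)⁻¹)) := by
  have hCn := ne_neg_nat_of_ne_int hCi
  have he' : 2 - e = 1 + (C - b) + (C - c) - C := by rw [he]; ring
  induction m generalizing a with
  | zero =>
    have h1 := sin_mul_Gamma_eq_saalZ he hee hb hc hCb hCc (ne_neg_nat_of_re_pos ha)
      (ne_neg_nat_of_re_pos hCa) (ne_neg_nat_of_re_pos ha') (ne_neg_nat_of_re_pos hCa') hC hCi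
      (ne_neg_nat_of_re_pos hCab) (ne_neg_nat_of_re_pos hCac)
    have e1 : a + 1 - e = C + a - b - c := by rw [he]; ring
    have h2 := tsum_gaussTerm (b := b) (c := c) (h := C + a) (e1 ▸ ha')
      (ne_neg_nat_of_re_pos hCa) (ne_neg_nat_of_re_pos hCab) (ne_neg_nat_of_re_pos hCac)
    rw [← e1] at h2
    have h3 : ∑' n : ℕ, hypCoeff b c C n * eulerBeta (C + (0 : ℕ) + n) a =
        Gamma C * Gamma a * ∑' n, gaussTerm b c (C + a) n := by
      rw [← tsum_mul_left]
      refine tsum_congr fun n => ?_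
      have := poch_ne_zero hCn n
      rw [hypCoeff, gaussTerm, eulerBeta, Nat.cast_zero, add_zero, Gamma_add_nat hCn,
        add_right_comm C]
      field_simp
    have h4 (a b c e : ℂ) : ∑' k : ℕ, gaussTerm b c e k * eulerBeta (C + (0 : ℕ)) (a + k) =
        Gamma C * ∑' k, saalTerm a b c e C k := by
      rw [← tsum_mul_left]
      refine tsum_congr fun k => ?_
      rw [saalTerm, eulerBeta, Nat.cast_zero, add_zero, add_assoc C]
      ring
    rw [h3, h4, h4, h2]
    rw [saalZ] at h1
    simp only [div_eq_mul_inv, mul_inv]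
    linear_combination Gamma C * h1
  | succ m ih =>
    have han := ne_neg_nat_of_re_pos ha
    have han' := ne_neg_nat_of_re_pos ha'
    have e1 : a + 1 - e = C + a - b - c := by rw [he]; ring
    have i0 := ih ha ha' hCa hCa' hCab hCac
    have i1 := ih (a := a + 1) (by simp at *; linarith) (by simp at *; linarith)
      (by simp at *; linarith) (by simp at *; linarith) (by simp at *; linarith)
      (by simp at *; linarith)
    have s0 := summable_hypCoeff_mul_eulerBeta (b := b) (c := c) hCn ha (e1 ▸ ha') m
    have s1 := summable_hypCoeff_mul_eulerBeta (a := a + 1) (b := b) (c := c) hCn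
      (by simp at *; linarith) (by rw [e1] at ha'; simp at *; linarith) m
    have e2 : ∑' n : ℕ, hypCoeff b c C n * eulerBeta (C + (m + 1 : ℕ) + n) a =
        ∑' n : ℕ, hypCoeff b c C n * eulerBeta (C + m + n) a -
        ∑' n : ℕ, hypCoeff b c C n * eulerBeta (C + m + n) (a + 1) := by
      rw [← s0.tsum_sub s1]
      refine tsum_congr fun n => ?_
      have h0 : C + m + n ≠ 0 := fun h => hCn (m + n) (by
        push_cast
        linear_combination h)
      have h1 : a ≠ 0 := by simpa using han 0
      push_cast
      rw [← add_assoc, add_right_comm (C + m), eulerBeta_add_one h0 h1]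
      ring
    rw [e2, tsum_gaussTerm_mul_eulerBeta_add_one he han hCn,
      tsum_gaussTerm_mul_eulerBeta_add_one he' han' hCn]
    rw [add_sub_right_comm (a + 1)] at i1
    linear_combination i0 - i1

lemma hypCoeff_mul_gaussTerm_mul_eulerBeta {C : ℂ} (hC : ∀ m : ℕ, C ≠ -m) (a b c e α β : ℂ)
    (m k : ℕ) : hypCoeff α β C m * (gaussTerm b c e k * eulerBeta (C + m) (a + k)) =
      Gamma C * (gaussTerm b c e k * Gamma (a + k)) * gaussTerm α β (C + a + k) m := by
  have := poch_ne_zero hC m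
  have e1 : C + m + (a + k) = C + a + k + m := by ring
  rw [hypCoeff, eulerBeta, Gamma_add_nat hC, e1, gaussTerm.eq_def α]
  field_simp

lemma summable_hypCoeff_mul_gaussTerm_mul_eulerBeta {a b c e C α β : ℂ} (he : e = 1 + b + c - C)
    (hC : ∀ m : ℕ, C ≠ -m) (ha : ∀ m : ℕ, a ≠ -m) (hd : 0 < (C + a - α - β).re)
    (hCa : 0 < (C + a).re) : Summable fun p : ℕ × ℕ =>
      hypCoeff α β C p.1 * (gaussTerm b c e p.2 * eulerBeta (C + p.1) (a + p.2)) := by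
  set y := (C + a).re with hy
  have hyn : ∀ m : ℕ, (y : ℂ) ≠ -m := ne_neg_nat_of_re_pos (by simpa using hCa)
  have s1 : Summable fun m => ‖gaussTerm α β y m‖ := summable_norm_gaussTerm (by
    simp [hy] at hd ⊢
    linarith)
  have s2 := s1.mul_of_nonneg (summable_norm_saalTerm he ha) (fun _ => norm_nonneg _)
    (fun _ => norm_nonneg _)
  refine Summable.of_norm_bounded (s2.mul_left (‖Gamma C‖ * ‖Gamma y‖)) fun p => ?_
  obtain ⟨m, k⟩ := p
  have hk : y ≤ (C + a + k).re := by simp [hy]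
  have hp0 : 0 < ‖poch (y : ℂ) m‖ := norm_pos_iff.2 (poch_ne_zero hyn m)
  have hp := norm_poch_ofReal_le hCa hk m
  have hp1 : poch (C + a + k) m ≠ 0 := norm_pos_iff.1 (hp0.trans_le hp)
  have h1 : gaussTerm α β (C + a + k) m = (Gamma (C + a + k))⁻¹ *
      (poch α m * poch β m * (m.factorial : ℂ)⁻¹) * (poch (C + a + k) m)⁻¹ := by
    rw [gaussTerm, inv_Gamma_eq (C + a + k) m]
    field_simp
  have h2 : poch α m * poch β m * (m.factorial : ℂ)⁻¹ * (poch (y : ℂ) m)⁻¹ =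
      Gamma y * gaussTerm α β y m := by
    have := Gamma_ne_zero hyn
    have := norm_pos_iff.1 hp0
    rw [gaussTerm, Gamma_add_nat hyn]
    field_simp
  rw [hypCoeff_mul_gaussTerm_mul_eulerBeta hC, h1]
  calc _ = ‖Gamma C‖ * ‖saalTerm a b c e C k‖ *
        (‖poch α m * poch β m * (m.factorial : ℂ)⁻¹‖ * ‖poch (C + a + k) m‖⁻¹) := by
        simp only [saalTerm, norm_mul, norm_inv]
        ring
    _ ≤ ‖Gamma C‖ * ‖saalTerm a b c e C k‖ *
        (‖poch α m * poch β m * (m.factorial : ℂ)⁻¹‖ * ‖poch (y : ℂ) m‖⁻¹) := by gcongr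
    _ = ‖Gamma C‖ * ‖saalTerm a b c e C k‖ * ‖Gamma y * gaussTerm α β y m‖ := by
        rw [← h2, norm_mul _ (poch (y : ℂ) m)⁻¹, norm_inv (poch (y : ℂ) m)]
    _ = _ := by
        rw [norm_mul]
        ring

lemma tsum_hypCoeff_mul_tsum_eulerBeta {a b c d e f g C α β : ℂ} (he : e = 1 + b + c - C)
    (hd : d = C + a - α - β) (hf : f = C + a - α) (hg : g = C + a - β)
    (hC : ∀ m : ℕ, C ≠ -m) (ha : ∀ m : ℕ, a ≠ -m) (hd0 : 0 < d.re) (hCa : 0 < (C + a).re)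
    (hf0 : ∀ m : ℕ, f ≠ -m) (hg0 : ∀ m : ℕ, g ≠ -m) :
    ∑' m : ℕ, hypCoeff α β C m * ∑' k : ℕ, gaussTerm b c e k * eulerBeta (C + m) (a + k) =
      Gamma C * Gamma a * Gamma d * Phi a b c d e f g := by
  have s := summable_hypCoeff_mul_gaussTerm_mul_eulerBeta he hC ha (hd ▸ hd0) hCa
  simp_rw [← tsum_mul_left]
  rw [← Summable.tsum_comm (f := fun m k : ℕ =>
    hypCoeff α β C m * (gaussTerm b c e k * eulerBeta (C + m) (a + k))) s, Phi, ← tsum_mul_left]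
  refine tsum_congr fun k => ?_
  simp_rw [hypCoeff_mul_gaussTerm_mul_eulerBeta hC]
  have e1 : C + a + k - α = f + k := by rw [hf]; ring
  have e2 : C + a + k - β = g + k := by rw [hg]; ring
  have e3 : C + a + k - α - β = d + k := by rw [hd]; ring
  rw [tsum_mul_left, tsum_gaussTerm, e3, e1, e2, Gamma_add_nat ha,
    Gamma_add_nat (ne_neg_nat_of_re_pos hd0), phiTerm, gaussTerm]
  · simp only [div_eq_mul_inv, mul_inv]
    ring
  · rw [e3]
    simp
    positivity
  · exact add_natCast_ne (ne_neg_nat_of_re_pos hCa) k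
  · rw [e1]
    exact add_natCast_ne hf0 k
  · rw [e2]
    exact add_natCast_ne hg0 k

lemma sin_mul_tsum_tsum_eulerBeta {a b c d e f g C α β : ℂ} (he : e = 1 + b + c - C)
    (hd : d = C + a - α - β) (hf : f = C + a - α) (hg : g = C + a - β)
    (hee : ∀ n : ℤ, e ≠ n) (hb : ∀ n : ℤ, b ≠ n) (hc : ∀ n : ℤ, c ≠ n)
    (hCb : ∀ n : ℤ, C - b ≠ n) (hCc : ∀ n : ℤ, C - c ≠ n) (hC : ‖C‖ + C.re < 1)
    (hCi : ∀ n : ℤ, C ≠ n) (ha : 0 < a.re) (ha' : 0 < (a + 1 - e).re)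
    (hCa : 0 < (C + a).re) (hCa' : 0 < (C + (a + 1 - e)).re)
    (hCab : 0 < (C + a - b).re) (hCac : 0 < (C + a - c).re)
    (hd0 : 0 < d.re) (hd' : 0 < (d + 1 - e).re) (hf0 : 0 < f.re) (hf' : 0 < (f + 1 - e).re)
    (hg0 : 0 < g.re) (hg' : 0 < (g + 1 - e).re) :
    Complex.sin (Real.pi * e) *
      ∑' m : ℕ, ∑' n : ℕ, hypCoeff α β C m * hypCoeff b c C n * eulerBeta (C + m + n) a =
      Real.pi * Gamma C ^ 2 * (Gamma a * Gamma d * Gamma (a + 1 - e) * Gamma (d + 1 - e)) *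
        Lnum a b c d e f g := by
  have hCn := ne_neg_nat_of_ne_int hCi
  have he' : 2 - e = 1 + (C - b) + (C - c) - C := by rw [he]; ring
  have hd1 : d + 1 - e = C + (a + 1 - e) - α - β := by rw [hd]; ring
  have hf1 : f + 1 - e = C + (a + 1 - e) - α := by rw [hf]; ring
  have hg1 : g + 1 - e = C + (a + 1 - e) - β := by rw [hg]; ring
  have han := ne_neg_nat_of_re_pos ha
  have han' := ne_neg_nat_of_re_pos ha'
  have s1 := (summable_hypCoeff_mul_gaussTerm_mul_eulerBeta he hCn han (hd ▸ hd0) hCa).prod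
  have s2 := (summable_hypCoeff_mul_gaussTerm_mul_eulerBeta he' hCn han' (hd1 ▸ hd') hCa').prod
  simp_rw [tsum_mul_left] at s1 s2
  have t1 := tsum_hypCoeff_mul_tsum_eulerBeta he hd hf hg hCn han hd0 hCa
    (ne_neg_nat_of_re_pos hf0) (ne_neg_nat_of_re_pos hg0)
  have t2 := tsum_hypCoeff_mul_tsum_eulerBeta he' hd1 hf1 hg1 hCn han' hd' hCa'
    (ne_neg_nat_of_re_pos hf') (ne_neg_nat_of_re_pos hg')
  have key (m : ℕ) : Complex.sin (Real.pi * e) *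
      ∑' n : ℕ, hypCoeff α β C m * hypCoeff b c C n * eulerBeta (C + m + n) a =
      Real.pi * Gamma C * ((Gamma (C - b))⁻¹ * (Gamma (C - c))⁻¹) *
        (hypCoeff α β C m * ∑' k : ℕ, gaussTerm b c e k * eulerBeta (C + m) (a + k)) -
      Real.pi * Gamma C * ((Gamma b)⁻¹ * (Gamma c)⁻¹) * (hypCoeff α β C m *
        ∑' k : ℕ, gaussTerm (C - b) (C - c) (2 - e) k * eulerBeta (C + m) (a + 1 - e + k)) := by
    have := sin_mul_tsum_hypCoeff_mul_eulerBeta he hee hb hc hCb hCc hC hCi m ha ha' hCa hCa'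
      hCab hCac
    simp_rw [mul_assoc (hypCoeff α β C m)]
    rw [tsum_mul_left]
    linear_combination hypCoeff α β C m * this
  rw [← tsum_mul_left, tsum_congr key, (s1.mul_left _).tsum_sub (s2.mul_left _), tsum_mul_left,
    tsum_mul_left, t1, t2, Phi_swap_bc _ (C - b), Lnum]
  have e1 : 1 + b - e = C - c := by rw [he]; ring
  have e2 : 1 + c - e = C - b := by rw [he]; ring
  have := Gamma_ne_zero han
  have := Gamma_ne_zero han'
  have := Gamma_ne_zero (ne_neg_nat_of_re_pos hd0)
  have := Gamma_ne_zero (ne_neg_nat_of_re_pos hd')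
  rw [e1, e2]
  simp only [add_comm (1 : ℂ)]
  field_simp

lemma summable_hypCoeff_mul_hypCoeff_mul_eulerBeta {a b c α β C : ℂ} (hC : ∀ m : ℕ, C ≠ -m)
    (ha : 0 < a.re) (h1 : 2 * (b + c - C).re < a.re) (h2 : 2 * (α + β - C).re < a.re) :
    Summable fun p : ℕ × ℕ =>
      hypCoeff α β C p.1 * hypCoeff b c C p.2 * eulerBeta (C + p.1 + p.2) a := by
  obtain ⟨K, hK0, hK⟩ := exists_norm_hypCoeff_le b c hC
  obtain ⟨K', hK0', hK'⟩ := exists_norm_hypCoeff_le α β hC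
  obtain ⟨L, hL0, hL⟩ := exists_norm_eulerBeta_le (a := a) hC
  have t1 : Summable fun n : ℕ => ((n : ℝ) + 1) ^ ((α + β - C).re - 1 - a.re / 2) :=
    summable_succ_rpow (by linarith)
  have t2 : Summable fun n : ℕ => ((n : ℝ) + 1) ^ ((b + c - C).re - 1 - a.re / 2) :=
    summable_succ_rpow (by linarith)
  refine Summable.of_norm_bounded ((t1.mul_of_nonneg t2 (fun n => by positivity)
    (fun n => by positivity)).mul_left (K' * K * L)) fun p => ?_
  obtain ⟨m, n⟩ := p
  have hm : (0 : ℝ) < (m : ℝ) + 1 := by positivity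
  have hn : (0 : ℝ) < (n : ℝ) + 1 := by positivity
  have hN : (0 : ℝ) < (m : ℝ) + n + 1 := by positivity
  have hb := hL (m + n)
  push_cast at hb
  rw [← add_assoc] at hb
  have h3 : ((m : ℝ) + n + 1) ^ (-a.re) ≤
      ((m : ℝ) + 1) ^ (-(a.re / 2)) * ((n : ℝ) + 1) ^ (-(a.re / 2)) := by
    have : -a.re = -(a.re / 2) + -(a.re / 2) := by ring
    rw [this, Real.rpow_add hN]
    gcongr ?_ * ?_
    · exact Real.rpow_le_rpow_of_nonpos hm (by linarith [(Nat.cast_nonneg n : (0 : ℝ) ≤ n)])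
        (by linarith)
    · exact Real.rpow_le_rpow_of_nonpos hn (by linarith [(Nat.cast_nonneg m : (0 : ℝ) ≤ m)])
        (by linarith)
  calc ‖hypCoeff α β C m * hypCoeff b c C n * eulerBeta (C + m + n) a‖
      = ‖hypCoeff α β C m‖ * ‖hypCoeff b c C n‖ * ‖eulerBeta (C + m + n) a‖ := by
        rw [norm_mul, norm_mul]
    _ ≤ (K' * ((m : ℝ) + 1) ^ ((α + β - C).re - 1)) * (K * ((n : ℝ) + 1) ^ ((b + c - C).re - 1)) *
        (L * (((m : ℝ) + 1) ^ (-(a.re / 2)) * ((n : ℝ) + 1) ^ (-(a.re / 2)))) := by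
        gcongr
        · exact hK' m
        · exact hK n
        · exact hb.trans (by gcongr)
    _ = K' * K * L * ((((m : ℝ) + 1) ^ ((α + β - C).re - 1) * ((m : ℝ) + 1) ^ (-(a.re / 2))) *
        (((n : ℝ) + 1) ^ ((b + c - C).re - 1) * ((n : ℝ) + 1) ^ (-(a.re / 2)))) := by ring
    _ = _ := by
        rw [← Real.rpow_add hm, ← Real.rpow_add hn]
        simp only [sub_eq_add_neg]

lemma sin_mul_Lnum_of_re_pos {a b c C α β e ε : ℂ} (he : e = 1 + b + c - C)
    (hε : ε = 1 + α + β - C) (hee : ∀ n : ℤ, e ≠ n) (hεε : ∀ n : ℤ, ε ≠ n)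
    (hb : ∀ n : ℤ, b ≠ n) (hc : ∀ n : ℤ, c ≠ n) (hα : ∀ n : ℤ, α ≠ n) (hβ : ∀ n : ℤ, β ≠ n)
    (hCb : ∀ n : ℤ, C - b ≠ n) (hCc : ∀ n : ℤ, C - c ≠ n) (hCα : ∀ n : ℤ, C - α ≠ n)
    (hCβ : ∀ n : ℤ, C - β ≠ n) (hC : ‖C‖ + C.re < 1) (hCi : ∀ n : ℤ, C ≠ n)
    (ha : 0 < a.re) (ha' : 0 < (C + a - b - c).re) (hCa : 0 < (C + a).re)
    (hCa' : 0 < (C + (C + a - b - c)).re) (hCab : 0 < (C + a - b).re)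
    (hCac : 0 < (C + a - c).re) (hCaα : 0 < (C + a - α).re) (hCaβ : 0 < (C + a - β).re)
    (hd : 0 < (C + a - α - β).re) (hCd : 0 < (C + (C + a - α - β)).re)
    (hd' : 0 < (C + (C + a - b - c) - α - β).re)
    (hf' : 0 < (C + (C + a - b - c) - α).re) (hg' : 0 < (C + (C + a - b - c) - β).re)
    (hφ' : 0 < (C + (C + a - α - β) - b).re) (hγ' : 0 < (C + (C + a - α - β) - c).re)
    (h1 : 2 * (b + c - C).re < a.re) (h2 : 2 * (α + β - C).re < a.re) :
    Complex.sin (Real.pi * ε) * Lnum a b c (C + a - α - β) e (C + a - α) (C + a - β) =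
      Complex.sin (Real.pi * e) * Lnum a α β (C + a - b - c) ε (C + a - b) (C + a - c) := by
  have hCn := ne_neg_nat_of_ne_int hCi
  have k1 : a + 1 - e = C + a - b - c := by rw [he]; ring
  have k2 : C + a - α - β + 1 - e = C + (C + a - b - c) - α - β := by rw [he]; ring
  have k3 : C + a - α + 1 - e = C + (C + a - b - c) - α := by rw [he]; ring
  have k4 : C + a - β + 1 - e = C + (C + a - b - c) - β := by rw [he]; ring
  have l1 : a + 1 - ε = C + a - α - β := by rw [hε]; ring
  have l2 : C + a - b - c + 1 - ε = C + (C + a - b - c) - α - β := by rw [hε]; ring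
  have l3 : C + a - b + 1 - ε = C + (C + a - α - β) - b := by rw [hε]; ring
  have l4 : C + a - c + 1 - ε = C + (C + a - α - β) - c := by rw [hε]; ring
  have i1 := sin_mul_tsum_tsum_eulerBeta (a := a) (α := α) (β := β) he rfl rfl rfl hee hb hc hCb
    hCc hC hCi ha (k1 ▸ ha') hCa (k1 ▸ hCa') hCab hCac hd (k2 ▸ hd') hCaα (k3 ▸ hf') hCaβ
    (k4 ▸ hg')
  have i2 := sin_mul_tsum_tsum_eulerBeta (a := a) (α := b) (β := c) hε rfl rfl rfl hεε hα hβ hCα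
    hCβ hC hCi ha (l1 ▸ hd) hCa (l1 ▸ hCd) hCaα hCaβ ha' (l2 ▸ hd') hCab (l3 ▸ hφ') hCac
    (l4 ▸ hγ')
  have s := Summable.tsum_comm (f := fun m n : ℕ =>
    hypCoeff α β C m * hypCoeff b c C n * eulerBeta (C + m + n) a)
    (summable_hypCoeff_mul_hypCoeff_mul_eulerBeta hCn ha h1 h2)
  have s' : ∑' m : ℕ, ∑' n : ℕ, hypCoeff b c C m * hypCoeff α β C n * eulerBeta (C + m + n) a =
      ∑' m : ℕ, ∑' n : ℕ, hypCoeff α β C m * hypCoeff b c C n * eulerBeta (C + m + n) a := by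
    rw [← s]
    refine tsum_congr fun m => tsum_congr fun n => ?_
    rw [mul_comm (hypCoeff b c C m), add_right_comm C]
  rw [s'] at i2
  rw [k1, k2] at i1
  rw [l1, l2] at i2
  have g1 := Gamma_ne_zero (ne_neg_nat_of_re_pos ha)
  have g2 := Gamma_ne_zero (ne_neg_nat_of_re_pos ha')
  have g3 := Gamma_ne_zero (ne_neg_nat_of_re_pos hd)
  have g4 := Gamma_ne_zero (ne_neg_nat_of_re_pos hd')
  have g5 := Gamma_ne_zero hCn
  have hpi : (Real.pi : ℂ) ≠ 0 := by exact_mod_cast Real.pi_ne_zero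
  have : (Real.pi : ℂ) * Gamma C ^ 2 * (Gamma a * Gamma (C + a - α - β) * Gamma (C + a - b - c) *
      Gamma (C + (C + a - b - c) - α - β)) ≠ 0 := by
    simp [*]
  refine mul_left_cancel₀ this ?_
  linear_combination Complex.sin (Real.pi * e) * i2 - Complex.sin (Real.pi * ε) * i1

lemma ne_intCast_of_im_ne_zero {x : ℂ} (hx : x.im ≠ 0) (n : ℤ) : x ≠ n := fun h => hx (by simp [h])

lemma norm_add_re_lt_one {x y : ℝ} (hx : 0 < x) (h : y ^ 2 < x) {w : ℂ} (h1 : w.re = -x)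
    (h2 : w.im = -y) : ‖w‖ + w.re < 1 := by
  have : ‖w‖ < 1 + x := by
    rw [norm_def, normSq_apply, h1, h2]
    refine (Real.sqrt_lt' (by positivity)).2 ?_
    nlinarith
  linarith

/-- Interchange of the pairs `(b, c)` and `(α, β)`. -/
lemma sin_mul_Lnum_comm {a b c C α β e ε : ℂ} (he : e = 1 + b + c - C)
    (hε : ε = 1 + α + β - C) (hee : ∀ n : ℤ, e ≠ n) (hεε : ∀ n : ℤ, ε ≠ n)
    (hc : ∀ n : ℤ, c ≠ n) (hβ : ∀ n : ℤ, β ≠ n)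
    (hCb : ∀ n : ℤ, C - b ≠ n) (hCα : ∀ n : ℤ, C - α ≠ n) :
    Complex.sin (Real.pi * ε) * Lnum a b c (C + a - α - β) e (C + a - α) (C + a - β) =
      Complex.sin (Real.pi * e) * Lnum a α β (C + a - b - c) ε (C + a - b) (C + a - c) := by
  let F : ℂ → ℂ := fun z => Complex.sin (Real.pi * ε) *
    Lnum (a + 2 * z) (b - z) c (C - z + (a + 2 * z) - (α - z) - β) e
      (C - z + (a + 2 * z) - (α - z)) (C - z + (a + 2 * z) - β)
  let G : ℂ → ℂ := fun z => Complex.sin (Real.pi * e) *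
    Lnum (a + 2 * z) (α - z) β (C - z + (a + 2 * z) - (b - z) - c) ε
      (C - z + (a + 2 * z) - (b - z)) (C - z + (a + 2 * z) - c)
  have hF : Differentiable ℂ F := (differentiable_Lnum (by fun_prop) (by fun_prop) (by fun_prop)
    (by fun_prop) (by fun_prop) (by fun_prop) (by fun_prop)
    (fun z => by rw [he]; ring)).const_mul _
  have hG : Differentiable ℂ G := (differentiable_Lnum (by fun_prop) (by fun_prop) (by fun_prop)
    (by fun_prop) (by fun_prop) (by fun_prop) (by fun_prop)
    (fun z => by rw [hε]; ring)).const_mul _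
  obtain ⟨y, hy⟩ := Infinite.exists_notMem_finset
    ({0, (b - C).im, (α - C).im, -c.im, -β.im} : Finset ℝ)
  simp only [Finset.mem_insert, Finset.mem_singleton, not_or, sub_im] at hy
  obtain ⟨hy0, hyb, hyα, hyc, hyβ⟩ := hy
  set x₀ : ℝ := 1 + y ^ 2 + 6 * (|a.re| + |b.re| + |c.re| + |C.re| + |α.re| + |β.re|) with hx₀
  have key (x : ℝ) (hx : x₀ < x) : F (C + x + y * I) = G (C + x + y * I) := by
    set z : ℂ := C + x + y * I with hz
    have hzr : z.re = C.re + x := by simp [hz]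
    have hzi : z.im = C.im + y := by simp [hz]
    have a1 := le_abs_self a.re
    have a2 := neg_abs_le a.re
    have b1 := le_abs_self b.re
    have b2 := neg_abs_le b.re
    have c1 := le_abs_self c.re
    have c2 := neg_abs_le c.re
    have C1 := le_abs_self C.re
    have C2 := neg_abs_le C.re
    have α1 := le_abs_self α.re
    have α2 := neg_abs_le α.re
    have β1 := le_abs_self β.re
    have β2 := neg_abs_le β.re
    have y0 := sq_nonneg y
    have hCb' : C - z - (b - z) = C - b := by ring
    have hCα' : C - z - (α - z) = C - α := by ring
    refine sin_mul_Lnum_of_re_pos (C := C - z) (by rw [he]; ring) (by rw [hε]; ring) hee hεε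
      (ne_intCast_of_im_ne_zero ?_) hc (ne_intCast_of_im_ne_zero ?_) hβ (hCb' ▸ hCb)
      (ne_intCast_of_im_ne_zero ?_) (hCα' ▸ hCα) (ne_intCast_of_im_ne_zero ?_)
      (norm_add_re_lt_one (x := x) (y := y) ?_ ?_ ?_ ?_) (ne_intCast_of_im_ne_zero ?_)
      ?_ ?_ ?_ ?_ ?_ ?_ ?_ ?_ ?_ ?_ ?_ ?_ ?_ ?_ ?_ ?_ ?_
    · simp only [sub_im, hzi]
      exact fun h => hyb (by linarith)
    · simp only [sub_im, hzi]
      exact fun h => hyα (by linarith)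
    · simp only [sub_im, hzi]
      exact fun h => hyc (by linarith)
    · simp only [sub_im, hzi]
      exact fun h => hyβ (by linarith)
    · linarith
    · linarith
    · simp [hzr]
    · simp [hzi]
    · simp only [sub_im, hzi]
      exact fun h => hy0 (by linarith)
    all_goals
      simp only [add_re, sub_re, re_ofNat, im_ofNat, mul_re, zero_mul, sub_zero, hzr]
      linarith
  have htend : Tendsto (fun x : ℝ => C + x + y * I) (𝓝[>] x₀) (𝓝[≠] (C + x₀ + y * I)) := by
    refine tendsto_nhdsWithin_iff.2 ⟨?_, ?_⟩
    · have : Continuous fun x : ℝ => C + x + y * I := by fun_prop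
      exact (this.tendsto x₀).mono_left nhdsWithin_le_nhds
    · filter_upwards [self_mem_nhdsWithin] with x hx h
      simp at h
      exact (ne_of_gt hx) h
  have hfreq : ∃ᶠ z in 𝓝[≠] (C + x₀ + y * I), F z = G z :=
    htend.frequently (Eventually.frequently (by
      filter_upwards [self_mem_nhdsWithin] with x hx using key x hx))
  have hFG : F = G := AnalyticOnNhd.eq_of_frequently_eq
    (fun z _ => hF.analyticAt z) (fun z _ => hG.analyticAt z) hfreq
  simpa [F, G] using congrFun hFG 0

lemma Lnum_congr {a b c d e f g a' b' c' d' e' f' g' : ℂ} (ha : a = a') (hb : b = b')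
    (hc : c = c') (hd : d = d') (he : e = e') (hf : f = f') (hg : g = g') :
    Lnum a b c d e f g = Lnum a' b' c' d' e' f' g' := by
  rw [ha, hb, hc, hd, he, hf, hg]

lemma Phi_swap_ef (a b c d e f g : ℂ) : Phi a b c d e f g = Phi a b c d f e g :=
  tsum_congr fun k => by simp only [phiTerm]; ring

lemma Phi_swap_fg (a b c d e f g : ℂ) : Phi a b c d e f g = Phi a b c d e g f :=
  tsum_congr fun k => by simp only [phiTerm]; ring

lemma Phi_swap_ab (a b c d e f g : ℂ) : Phi a b c d e f g = Phi b a c d e f g :=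
  tsum_congr fun k => by simp only [phiTerm]; ring

lemma Phi_swap_bd (a b c d e f g : ℂ) : Phi a b c d e f g = Phi a d c b e f g :=
  tsum_congr fun k => by simp only [phiTerm]; ring

lemma Lnum_swap_fg (a b c d e f g : ℂ) : Lnum a b c d e f g = Lnum a b c d e g f := by
  simp only [Lnum, Phi_swap_fg _ _ _ _ _ f, Phi_swap_fg _ _ _ _ _ (1 + f - e)]

lemma Lnum_swap_ab (a b c d e f g : ℂ) : Lnum a b c d e f g = Lnum b a c d e f g := by
  simp only [Lnum, Phi_swap_ab a, Phi_swap_ab (1 + a - e)]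
  ring

lemma Lnum_swap_bd (a b c d e f g : ℂ) : Lnum a b c d e f g = Lnum a d c b e f g := by
  simp only [Lnum, Phi_swap_bd _ b, Phi_swap_bd _ (1 + b - e)]
  ring

lemma Lnum_swap_bc (a b c d e f g : ℂ) : Lnum a b c d e f g = Lnum a c b d e f g := by
  simp only [Lnum, Phi_swap_bc _ b, Phi_swap_bc _ (1 + b - e)]
  ring

lemma Lnum_flip (a b c d e f g : ℂ) :
    Lnum (1 + a - e) (1 + b - e) (1 + c - e) (1 + d - e) (2 - e) (1 + f - e) (1 + g - e) =
      -Lnum a b c d e f g := by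
  have h (x : ℂ) : 1 + (1 + x - e) - (2 - e) = x := by ring
  simp only [Lnum, h, sub_sub_cancel]
  ring

/-- The coboundary relation among the three functions `Lnum` built from two of the series. -/
lemma Lnum_cocycle (a b c d e f g : ℂ) :
    Lnum a b c d e f g * ((Gamma (1 + a - f))⁻¹ * (Gamma (1 + b - f))⁻¹ *
        (Gamma (1 + c - f))⁻¹ * (Gamma (1 + d - f))⁻¹) -
      Lnum a b c d f e g * ((Gamma (1 + a - e))⁻¹ * (Gamma (1 + b - e))⁻¹ *
        (Gamma (1 + c - e))⁻¹ * (Gamma (1 + d - e))⁻¹) =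
    -(Lnum (1 + a - e) (1 + b - e) (1 + c - e) (1 + d - e) (1 + f - e) (2 - e) (1 + g - e) *
      ((Gamma a)⁻¹ * (Gamma b)⁻¹ * (Gamma c)⁻¹ * (Gamma d)⁻¹)) := by
  have h (x : ℂ) : 1 + (1 + x - e) - (1 + f - e) = 1 + x - f := by ring
  have h1 : 2 - (1 + f - e) = 1 + e - f := by ring
  have h2 : 1 + (2 - e) - (1 + f - e) = 2 - f := by ring
  simp only [Lnum, h, h1, h2, Phi_swap_ef _ _ _ _ (2 - e), Phi_swap_ef _ _ _ _ (2 - f),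
    Phi_swap_ef _ _ _ _ f e]
  ring

lemma ne_int_of_eq_add {x y : ℂ} (hx : ∀ n : ℤ, x ≠ n) (k : ℤ) (h : y = k + x) (n : ℤ) :
    y ≠ n := fun hn => hx (n - k) (by
  push_cast
  linear_combination hn - h)

lemma ne_int_of_eq_sub {x y : ℂ} (hx : ∀ n : ℤ, x ≠ n) (k : ℤ) (h : y = k - x) (n : ℤ) :
    y ≠ n := fun hn => hx (k - n) (by
  push_cast
  linear_combination h - hn)

lemma Sn_neg (x : ℂ) : Sn (-x) = -Sn x := by simp [Sn]

lemma Sn_one_add (x : ℂ) : Sn (1 + x) = -Sn x := by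
  rw [Sn, Sn, mul_add, mul_one, add_comm, Complex.sin_add_pi]

lemma Sn_two_sub (x : ℂ) : Sn (2 - x) = -Sn x := by
  have : 2 - x = 1 + (1 + -x) := by ring
  rw [this, Sn_one_add, Sn_one_add, Sn_neg, neg_neg]

lemma Sn_sub_comm (x y : ℂ) : Sn (x - y) = -Sn (y - x) := by rw [← Sn_neg, neg_sub]

lemma Sn_mul_Lnum {a b c d e f g : ℂ} (h : e + f + g = a + b + c + d + 1)
    (he : ∀ n : ℤ, e ≠ n) (hda : ∀ n : ℤ, d - a ≠ n) (hc : ∀ n : ℤ, c ≠ n)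
    (hfd : ∀ n : ℤ, f - d ≠ n) (hec : ∀ n : ℤ, e - c ≠ n) (hfa : ∀ n : ℤ, f - a ≠ n) :
    Sn (a - d) * Lnum a b c d e f g =
      -(Sn e * Lnum a (g - d) (f - d) (1 + a - e) (1 + a - d) (f + g - d - b) (f + g - d - c)) := by
  have key := sin_mul_Lnum_comm (a := a) (b := b) (c := c) (C := f + g - a - d) (α := g - d)
    (β := f - d) (e := e) (ε := 1 + a - d) (by linear_combination h) (by ring) he
    (ne_int_of_eq_sub hda 1 (by push_cast; ring)) hc hfd
    (ne_int_of_eq_sub hec 1 (by push_cast; linear_combination h))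
    (ne_int_of_eq_add hfa 0 (by push_cast; ring))
  have e1 : Sn (a - d) = -Sn (1 + a - d) := by rw [add_sub_assoc, Sn_one_add, neg_neg]
  rw [e1, neg_mul]
  refine congrArg Neg.neg (Eq.trans ?_ (key.trans ?_))
  · exact congrArg _ (Lnum_congr rfl rfl rfl (by ring) rfl (by ring) (by ring))
  · exact congrArg _ (Lnum_congr rfl rfl rfl (by linear_combination h) rfl (by ring) (by ring))

/-- The two-term relation for `Lnum`. -/
lemma Sn_mul_Lnum_two_term {a b c d e f g : ℂ} (h : e + f + g = a + b + c + d + 1)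
    (he : ∀ n : ℤ, e ≠ n) (hda : ∀ n : ℤ, d - a ≠ n) (hc : ∀ n : ℤ, c ≠ n)
    (hfd : ∀ n : ℤ, f - d ≠ n) (hec : ∀ n : ℤ, e - c ≠ n) (hfa : ∀ n : ℤ, f - a ≠ n)
    (hgf : ∀ n : ℤ, g - f ≠ n) (hfc : ∀ n : ℤ, f - c ≠ n) (hed : ∀ n : ℤ, e - d ≠ n)
    (hgc : ∀ n : ℤ, g - c ≠ n) (hea : ∀ n : ℤ, e - a ≠ n) :
    Sn (f - g) * Lnum a b c d e f g =
      -(Sn e * Lnum (f - a) (f - b) (f - c) (f - d) (1 + f - g) (1 + f - e) f) := by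
  have k1 := Sn_mul_Lnum h he hda hc hfd hec hfa
  have k2 := Sn_mul_Lnum (a := f - a) (b := f - b) (c := f - c) (d := f - d) (e := 1 + f - g)
    (f := 1 + f - e) (g := f) (by linear_combination -h)
    (ne_int_of_eq_sub hgf 1 (by push_cast; ring))
    (ne_int_of_eq_sub hda 0 (by push_cast; ring)) hfc
    (ne_int_of_eq_sub hed 1 (by push_cast; ring))
    (ne_int_of_eq_sub hgc 1 (by push_cast; ring))
    (ne_int_of_eq_sub hea 1 (by push_cast; ring))
  have hs : Sn (a - d) ≠ 0 := by
    rw [Sn_sub_comm]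
    exact neg_ne_zero.2 (sin_pi_mul_ne_zero_of_ne_int hda)
  have k3 : Lnum (f - a) (f - (f - d)) (1 + f - e - (f - d)) (1 + (f - a) - (1 + f - g))
      (1 + (f - a) - (f - d)) (1 + f - e + f - (f - d) - (f - b))
      (1 + f - e + f - (f - d) - (f - c)) =
      -Lnum a (g - d) (f - d) (1 + a - e) (1 + a - d) (f + g - d - b) (f + g - d - c) := by
    rw [← Lnum_flip, Lnum_swap_ab, Lnum_swap_bc, Lnum_swap_bd, Lnum_swap_fg]
    exact Lnum_congr (by ring) (by ring) (by ring) (by ring) (by ring)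
      (by linear_combination -h) (by linear_combination -h)
  have k4 : Sn (f - a - (f - d)) = -Sn (a - d) := by
    rw [← Sn_neg]
    congr 1
    ring
  have k5 : Sn (1 + f - g) = -Sn (f - g) := by rw [add_sub_assoc, Sn_one_add]
  rw [k3, k4, k5] at k2
  refine mul_left_cancel₀ hs ?_
  linear_combination Sn (f - g) * k1 - Sn e * k2

lemma Fstar_eq_Phi {a b c d : ℂ} (ha : ∀ n : ℤ, a ≠ n) (hb : ∀ n : ℤ, b ≠ n)
    (hc : ∀ n : ℤ, c ≠ n) (hd : ∀ n : ℤ, d ≠ n) (e f g : ℂ) :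
    Fstar a b c d e f g = Gamma a * Gamma b * Gamma c * Gamma d * Phi a b c d e f g := by
  rw [Fstar, Phi, ← tsum_mul_left]
  refine tsum_congr fun k => ?_
  simp only [add_comm (k : ℂ)]
  rw [Gamma_add_nat (ne_neg_nat_of_ne_int ha), Gamma_add_nat (ne_neg_nat_of_ne_int hb),
    Gamma_add_nat (ne_neg_nat_of_ne_int hc), Gamma_add_nat (ne_neg_nat_of_ne_int hd), phiTerm]
  simp only [div_eq_mul_inv, mul_inv]
  ring

lemma Lf_eq_Lnum {a b c d e : ℂ} (ha : ∀ n : ℤ, a ≠ n) (hb : ∀ n : ℤ, b ≠ n)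
    (hc : ∀ n : ℤ, c ≠ n) (hd : ∀ n : ℤ, d ≠ n) (hea : ∀ n : ℤ, e - a ≠ n)
    (heb : ∀ n : ℤ, e - b ≠ n) (hec : ∀ n : ℤ, e - c ≠ n) (hed : ∀ n : ℤ, e - d ≠ n) (f g : ℂ) :
    Lf a b c d e f g = Lnum a b c d e f g / Sn e := by
  have h {x : ℂ} (hx : ∀ n : ℤ, e - x ≠ n) : ∀ n : ℤ, 1 + x - e ≠ n :=
    ne_int_of_eq_sub hx 1 (by push_cast; ring)
  have hG {x : ℂ} (hx : ∀ n : ℤ, x ≠ n) := Gamma_ne_zero (ne_neg_nat_of_ne_int hx)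
  rw [Lf, Fstar_eq_Phi ha hb hc hd, Fstar_eq_Phi (h hea) (h heb) (h hec) (h hed), Lnum]
  have := hG ha
  have := hG hb
  have := hG hc
  have := hG hd
  have := hG (h hea)
  have := hG (h heb)
  have := hG (h hec)
  have := hG (h hed)
  field_simp

lemma Sn_sub_eq (x y : ℂ) : Sn (x - y) = (cexp (Real.pi * x * I) ^ 2 - cexp (Real.pi * y * I) ^ 2) /
    (2 * I * cexp (Real.pi * x * I) * cexp (Real.pi * y * I)) := by
  have e1 : cexp (Real.pi * (x - y) * I) = cexp (Real.pi * x * I) / cexp (Real.pi * y * I) := by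
    rw [← Complex.exp_sub]
    ring_nf
  have hx := Complex.exp_ne_zero (Real.pi * x * I)
  have hy := Complex.exp_ne_zero (Real.pi * y * I)
  rw [Sn, Complex.sin, neg_mul, Complex.exp_neg, e1]
  generalize cexp (Real.pi * x * I) = X at *
  generalize cexp (Real.pi * y * I) = Y at *
  have hI : I ≠ 0 := I_ne_zero
  field_simp
  linear_combination (Y ^ 2 - X ^ 2) * I_sq

lemma Sn_four_term {a b c d e f g : ℂ} (h : e + f + g = a + b + c + d + 1) :
    Sn e * (Sn f * Sn (f - e) * Sn (g - a) * Sn (g - b) * Sn (g - c) * Sn (g - d) -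
      Sn g * Sn (g - e) * Sn (f - a) * Sn (f - b) * Sn (f - c) * Sn (f - d)) =
    Sn (f - g) * (Sn f * Sn g * (Sn (e - a) * Sn (e - b) * Sn (e - c) * Sn (e - d)) -
      Sn (e - f) * Sn (e - g) * (Sn a * Sn b * Sn c * Sn d)) := by
  have hE : cexp (Real.pi * e * I) * cexp (Real.pi * f * I) * cexp (Real.pi * g * I) =
      -(cexp (Real.pi * a * I) * cexp (Real.pi * b * I) * cexp (Real.pi * c * I) *
        cexp (Real.pi * d * I)) := by
    rw [← Complex.exp_add, ← Complex.exp_add, ← Complex.exp_add, ← Complex.exp_add,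
      ← Complex.exp_add, ← mul_neg_one, ← Complex.exp_pi_mul_I, ← Complex.exp_add]
    congr 1
    linear_combination Real.pi * I * h
  have hx (x : ℂ) := Sn_sub_eq x 0
  simp only [sub_zero, mul_zero, zero_mul, Complex.exp_zero, mul_one] at hx
  have e1 : Sn a * Sn b * Sn c * Sn d = Sn (0 - a) * Sn (0 - b) * Sn (0 - c) * Sn (0 - d) := by
    simp only [zero_sub, Sn_neg]
    ring
  have hP (p : ℂ) := congrArg₂ (· * ·) (congrArg₂ (· * ·) (congrArg₂ (· * ·)
    (Sn_sub_eq p a) (Sn_sub_eq p b)) (Sn_sub_eq p c)) (Sn_sub_eq p d)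
  have hg := hP g
  have hf := hP f
  have he := hP e
  have h0 := hP 0
  have e2 : Sn e * (Sn f * Sn (f - e) * Sn (g - a) * Sn (g - b) * Sn (g - c) * Sn (g - d) -
      Sn g * Sn (g - e) * Sn (f - a) * Sn (f - b) * Sn (f - c) * Sn (f - d)) =
      Sn e * (Sn f * Sn (f - e) * (Sn (g - a) * Sn (g - b) * Sn (g - c) * Sn (g - d)) -
      Sn g * Sn (g - e) * (Sn (f - a) * Sn (f - b) * Sn (f - c) * Sn (f - d))) := by ring
  simp only [mul_zero, zero_mul, Complex.exp_zero] at h0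
  rw [e2, e1, hg, hf, he, h0, hx e, hx f, hx g, Sn_sub_eq f e, Sn_sub_eq g e, Sn_sub_eq f g,
    Sn_sub_eq e f, Sn_sub_eq e g]
  have hA := Complex.exp_ne_zero (Real.pi * a * I)
  have hB := Complex.exp_ne_zero (Real.pi * b * I)
  have hC := Complex.exp_ne_zero (Real.pi * c * I)
  have hD := Complex.exp_ne_zero (Real.pi * d * I)
  have hE0 := Complex.exp_ne_zero (Real.pi * e * I)
  have hF := Complex.exp_ne_zero (Real.pi * f * I)
  have hG := Complex.exp_ne_zero (Real.pi * g * I)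
  clear hg hf he h0 hP hx e1 e2
  generalize cexp (Real.pi * a * I) = A at *
  generalize cexp (Real.pi * b * I) = B at *
  generalize cexp (Real.pi * c * I) = C at *
  generalize cexp (Real.pi * d * I) = D at *
  generalize cexp (Real.pi * e * I) = E at *
  generalize cexp (Real.pi * f * I) = F at *
  generalize cexp (Real.pi * g * I) = G at *
  have hsq : E ^ 2 * F ^ 2 * G ^ 2 = A ^ 2 * B ^ 2 * C ^ 2 * D ^ 2 := by
    linear_combination (E * F * G - A * B * C * D) * hE
  have hP (X : ℂ) (hX : X ≠ 0) : (X ^ 2 - A ^ 2) / (2 * I * X * A) *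
      ((X ^ 2 - B ^ 2) / (2 * I * X * B)) * ((X ^ 2 - C ^ 2) / (2 * I * X * C)) *
      ((X ^ 2 - D ^ 2) / (2 * I * X * D)) =
      -((X ^ 2 - A ^ 2) * (X ^ 2 - B ^ 2) * (X ^ 2 - C ^ 2) * (X ^ 2 - D ^ 2)) /
        (16 * X ^ 4 * (E * F * G)) := by
    rw [hE]
    have hI : I ≠ 0 := I_ne_zero
    field_simp
    simp only [I_pow_four]
    ring
  rw [hP G hG, hP F hF, hP E hE0, hP 1 one_ne_zero]
  have hI : I ≠ 0 := I_ne_zero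
  obtain ⟨s₁, s₂, s₃, hs⟩ : ∃ s₁ s₂ s₃ : ℂ, ∀ X : ℂ,
      (X ^ 2 - A ^ 2) * (X ^ 2 - B ^ 2) * (X ^ 2 - C ^ 2) * (X ^ 2 - D ^ 2) =
        X ^ 8 - s₁ * X ^ 6 + s₂ * X ^ 4 - s₃ * X ^ 2 + E ^ 2 * F ^ 2 * G ^ 2 :=
    ⟨A ^ 2 + B ^ 2 + C ^ 2 + D ^ 2, A ^ 2 * B ^ 2 + A ^ 2 * C ^ 2 + A ^ 2 * D ^ 2 +
      B ^ 2 * C ^ 2 + B ^ 2 * D ^ 2 + C ^ 2 * D ^ 2, A ^ 2 * B ^ 2 * C ^ 2 +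
      A ^ 2 * B ^ 2 * D ^ 2 + A ^ 2 * C ^ 2 * D ^ 2 + B ^ 2 * C ^ 2 * D ^ 2, fun X => by
        rw [hsq]
        ring⟩
  simp only [hs]
  field_simp
  ring

end

theorem incoherent_LLL_relation (a b c d e f g : ℂ)
    (hsaal : e + f + g = a + b + c + d + 1)
    (hint : ∀ i : Fin 7, ∀ n : ℤ, ![a, b, c, d, e, f, g] i ≠ (n : ℂ))
    (hdiff : ∀ i j : Fin 7, i ≠ j → ∀ n : ℤ,
      ![a, b, c, d, e, f, g] i - ![a, b, c, d, e, f, g] j ≠ (n : ℂ)) :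
    Sn g * Af (1 + a - f) (1 + b - f) (1 + c - f) (1 + d - f) *
        Af (e - a) (e - b) (e - c) (e - d) * Lf a b c d e f g +
      Sn (e - f) * Af a b c d * Af (g - a) (g - b) (g - c) (g - d) *
        Lf (1 - a) (1 - b) (1 - c) (1 - d) (2 - e) (2 - f) (2 - g) -
      B3 a b c d e f g * Lf a b c d f e g = 0 := by
  have na : ∀ n : ℤ, a ≠ n := hint 0
  have nb : ∀ n : ℤ, b ≠ n := hint 1
  have nc : ∀ n : ℤ, c ≠ n := hint 2
  have nd : ∀ n : ℤ, d ≠ n := hint 3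
  have ne : ∀ n : ℤ, e ≠ n := hint 4
  have nf : ∀ n : ℤ, f ≠ n := hint 5
  have ng : ∀ n : ℤ, g ≠ n := hint 6
  have nda : ∀ n : ℤ, d - a ≠ n := hdiff 3 0 (by decide)
  have nea : ∀ n : ℤ, e - a ≠ n := hdiff 4 0 (by decide)
  have neb : ∀ n : ℤ, e - b ≠ n := hdiff 4 1 (by decide)
  have nec : ∀ n : ℤ, e - c ≠ n := hdiff 4 2 (by decide)
  have ned : ∀ n : ℤ, e - d ≠ n := hdiff 4 3 (by decide)
  have nfa : ∀ n : ℤ, f - a ≠ n := hdiff 5 0 (by decide)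
  have nfb : ∀ n : ℤ, f - b ≠ n := hdiff 5 1 (by decide)
  have nfc : ∀ n : ℤ, f - c ≠ n := hdiff 5 2 (by decide)
  have nfd : ∀ n : ℤ, f - d ≠ n := hdiff 5 3 (by decide)
  have nfe : ∀ n : ℤ, f - e ≠ n := hdiff 5 4 (by decide)
  have ngc : ∀ n : ℤ, g - c ≠ n := hdiff 6 2 (by decide)
  have nge : ∀ n : ℤ, g - e ≠ n := hdiff 6 4 (by decide)
  have nfg : ∀ n : ℤ, f - g ≠ n := hdiff 5 6 (by decide)
  have hone {x : ℂ} (hx : ∀ n : ℤ, x ≠ n) : ∀ n : ℤ, 1 - x ≠ n :=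
    ne_int_of_eq_sub hx 1 (by push_cast; ring)
  have hdual {x : ℂ} (hx : ∀ n : ℤ, e - x ≠ n) : ∀ n : ℤ, 2 - e - (1 - x) ≠ n :=
    ne_int_of_eq_sub hx 1 (by push_cast; ring)
  have se : Sn e ≠ 0 := sin_pi_mul_ne_zero_of_ne_int ne
  have sf : Sn f ≠ 0 := sin_pi_mul_ne_zero_of_ne_int nf
  have sfg : Sn (f - g) ≠ 0 := sin_pi_mul_ne_zero_of_ne_int nfg
  have hpi : (Real.pi : ℂ) ≠ 0 := by exact_mod_cast Real.pi_ne_zero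
  rw [Lf_eq_Lnum na nb nc nd nea neb nec ned, Lf_eq_Lnum na nb nc nd nfa nfb nfc nfd,
    Lf_eq_Lnum (hone na) (hone nb) (hone nc) (hone nd) (hdual nea) (hdual neb) (hdual nec)
      (hdual ned)]
  have c1 := Lnum_cocycle a b c d e f g
  have c2 := Lnum_cocycle (1 - a) (1 - b) (1 - c) (1 - d) (2 - e) (2 - g) (2 - f)
  have t1 := Sn_mul_Lnum_two_term (a := a) (b := b) (c := c) (d := d) (e := f) (f := e) (g := g)
    (by linear_combination hsaal) nf nda nc ned nfc nea nge nec nfd ngc nfa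
  have t2 := Sn_mul_Lnum_two_term (a := 1 + a - e) (b := 1 + b - e) (c := 1 + c - e)
    (d := 1 + d - e) (e := 1 + f - e) (f := 2 - e) (g := 1 + g - e)
    (by linear_combination hsaal) (ne_int_of_eq_add nfe 1 (by push_cast; ring))
    (ne_int_of_eq_add nda 0 (by push_cast; ring)) (ne_int_of_eq_sub nec 1 (by push_cast; ring))
    (ne_int_of_eq_sub nd 1 (by push_cast; ring)) (ne_int_of_eq_add nfc 0 (by push_cast; ring))
    (ne_int_of_eq_sub na 1 (by push_cast; ring)) (ne_int_of_eq_add ng (-1) (by push_cast; ring))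
    (ne_int_of_eq_sub nc 1 (by push_cast; ring)) (ne_int_of_eq_add nfd 0 (by push_cast; ring))
    (ne_int_of_eq_add ngc 0 (by push_cast; ring)) (ne_int_of_eq_add nfa 0 (by push_cast; ring))
  have r1 (x y : ℂ) : 1 + (1 - x) - (2 - y) = y - x := by ring
  have r2 (x : ℂ) : 2 - e - (1 + x - e) = 1 - x := by ring
  have r3 (x : ℂ) : 1 + (2 - e) - (1 + x - e) = 2 - x := by ring
  have r4 (x : ℂ) : 1 + (2 - x) - (2 - e) = 1 + e - x := by ring
  have r5 : Sn (1 - g) = Sn g := by rw [sub_eq_add_neg, Sn_one_add, Sn_neg, neg_neg]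
  have r6 : Sn (1 + f - e) = Sn (e - f) := by rw [add_sub_assoc, Sn_one_add, Sn_sub_comm e]
  simp only [r1, r4, sub_sub_cancel] at c2
  simp only [r2, r3] at t2
  rw [Lnum_swap_fg _ _ _ _ (2 - e), Lnum_swap_fg _ _ _ _ (1 + e - g)] at c2
  rw [Lnum_swap_fg _ _ _ _ (2 - g), r5, r6] at t2
  have hB : Sn e * B3 a b c d e f g = Sn f * Sn g *
      (((Gamma (1 + a - e))⁻¹ * (Gamma (1 + b - e))⁻¹ * (Gamma (1 + c - e))⁻¹ *
        (Gamma (1 + d - e))⁻¹) * ((Gamma (e - a))⁻¹ * (Gamma (e - b))⁻¹ * (Gamma (e - c))⁻¹ *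
        (Gamma (e - d))⁻¹)) - Sn (e - f) * Sn (e - g) *
      (((Gamma a)⁻¹ * (Gamma b)⁻¹ * (Gamma c)⁻¹ * (Gamma d)⁻¹) *
      ((Gamma (1 - a))⁻¹ * (Gamma (1 - b))⁻¹ * (Gamma (1 - c))⁻¹ * (Gamma (1 - d))⁻¹)) := by
    have h1 (x : ℂ) : (Gamma x)⁻¹ * (Gamma (1 - x))⁻¹ = Sn x / Real.pi :=
      inv_Gamma_mul_inv_Gamma_one_sub x
    have h2 (x : ℂ) : (Gamma (1 + x - e))⁻¹ * (Gamma (e - x))⁻¹ = Sn (e - x) / Real.pi := by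
      rw [← h1, mul_comm, sub_sub_eq_add_sub]
    have h3 (p q r s p' q' r' s' : ℂ) : p * q * r * s * (p' * q' * r' * s') =
        p * p' * (q * q') * (r * r') * (s * s') := by ring
    rw [h3, h3]
    simp only [h1, h2]
    rw [B3]
    field_simp
    linear_combination Sn_four_term hsaal
  simp only [Af, one_div, mul_inv, Sn_two_sub]
  rw [eq_div_of_mul_eq se ((mul_comm _ _).trans hB)]
  generalize (Gamma a)⁻¹ * (Gamma b)⁻¹ * (Gamma c)⁻¹ * (Gamma d)⁻¹ = u₀ at *
  generalize (Gamma (1 - a))⁻¹ * (Gamma (1 - b))⁻¹ * (Gamma (1 - c))⁻¹ * (Gamma (1 - d))⁻¹ = v₀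
    at *
  generalize (Gamma (1 + a - e))⁻¹ * (Gamma (1 + b - e))⁻¹ * (Gamma (1 + c - e))⁻¹ *
    (Gamma (1 + d - e))⁻¹ = u₁ at *
  generalize (Gamma (e - a))⁻¹ * (Gamma (e - b))⁻¹ * (Gamma (e - c))⁻¹ * (Gamma (e - d))⁻¹ = v₁
    at *
  generalize (Gamma (1 + a - f))⁻¹ * (Gamma (1 + b - f))⁻¹ * (Gamma (1 + c - f))⁻¹ *
    (Gamma (1 + d - f))⁻¹ = u₂ at *
  generalize (Gamma (g - a))⁻¹ * (Gamma (g - b))⁻¹ * (Gamma (g - c))⁻¹ * (Gamma (g - d))⁻¹ = v₂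
    at *
  field_simp
  linear_combination Sn f * Sn g * v₁ * c1 - Sn f * Sn (e - f) * u₀ * c2 +
    Sn (e - f) * u₀ * v₀ * t1 - Sn f * u₀ * v₁ * t2
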